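/- arXiv:2210.09047 — 5 statements merged into one kernel-verified Lean document; each statement's English description precedes it below -/
import Mathlib

section
/- For every s > −1/2, the closure in ℝ of the set { Δ_s(X)/σ_X : X a square-integrable real random variable with σ_X > 0 } equals the interval [0, 1/√(2s+1)], where σ_X = √(Var X). In particular Δ_s(X) ≤ σ_X/√(2s+1) for every square-integrable X. -/
open MeasureTheory Set

/-- The integrand `t ↦ (1/s) t (1 − t^s)` of the cumulative Tsallis entropy, with the
convention `(1 − t^0)/0 = −log t` at `s = 0`. -/
noncomputable def tsallisFn (s t : ℝ) : ℝ :=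
  if s = 0 then -(t * Real.log t) else (1 / s) * (t * (1 - t ^ s))

/-- The variance of a probability measure `μ` on `ℝ`. -/
noncomputable def mVar (μ : Measure ℝ) : ℝ :=
  ∫ x, (x - ∫ y, y ∂μ) ^ 2 ∂μ

namespace TR
/-- minus derivative of tsallisFn -/
noncomputable def gF (s u : ℝ) : ℝ :=
  if s = 0 then 1 + Real.log u else (1 / s) * ((s + 1) * u ^ s - 1)

lemma hd_congr {f g : ℝ → ℝ} {d e x : ℝ} (h : HasDerivAt f d x) (h1 : g = f) (h2 : e = d) :
    HasDerivAt g e x := by rw [h1, h2]; exact h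

noncomputable def nu : Measure ℝ := volume.restrict (Ioo 0 1)

instance : IsProbabilityMeasure nu := ⟨by simp [nu]⟩

noncomputable def hK (q x : ℝ) : ℝ := (if x < q then 1 else 0) - (if x < 0 then 1 else 0)

lemma hK_eq (q : ℝ) : hK q = fun x => (Ico 0 q).indicator (fun _ => (1:ℝ)) x
    - (Ico q 0).indicator (fun _ => (1:ℝ)) x := by
  funext x
  simp only [hK, indicator, mem_Ico]
  split_ifs <;> first | (exfalso; grind; done) | (norm_num; done)

lemma hK_abs (q : ℝ) : (fun x => ‖hK q x‖) = fun x => (Ico 0 q).indicator (fun _ => (1:ℝ)) x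
    + (Ico q 0).indicator (fun _ => (1:ℝ)) x := by
  funext x
  simp only [hK, indicator, mem_Ico]
  split_ifs <;> first | (exfalso; grind; done) | (norm_num; done)

lemma ind_int (a b : ℝ) : Integrable ((Ico a b).indicator (fun _ => (1:ℝ))) := by
  rw [integrable_indicator_iff measurableSet_Ico]
  exact integrableOn_const (by simp)

lemma ind_val (a b : ℝ) : ∫ x, (Ico a b).indicator (fun _ => (1:ℝ)) x = max (b - a) 0 := by
  rw [integral_indicator measurableSet_Ico]
  simp [Measure.real, ENNReal.toReal_ofReal']

lemma hK_int (q : ℝ) : Integrable (hK q) := by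
  rw [hK_eq]; exact (ind_int _ _).sub (ind_int _ _)

lemma hK_val (q : ℝ) : ∫ x, hK q x = q := by
  rw [hK_eq, integral_sub (ind_int _ _) (ind_int _ _), ind_val, ind_val]
  grind

lemma hK_absval (q : ℝ) : ∫ x, ‖hK q x‖ = |q| := by
  rw [hK_abs, integral_add (ind_int _ _) (ind_int _ _), ind_val, ind_val]
  grind

lemma meas_gF (s : ℝ) : Measurable (gF s) := by
  unfold gF
  split_ifs <;> fun_prop

lemma rpow_int {a : ℝ} (ha : -1 < a) : Integrable (fun u : ℝ => u ^ a) nu := by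
  have := (intervalIntegral.intervalIntegrable_rpow' (a := 0) (b := 1) ha)
  rw [intervalIntegrable_iff_integrableOn_Ioo_of_le zero_le_one] at this
  exact this

lemma nu_int (f : ℝ → ℝ) : ∫ u, f u ∂nu = ∫ u in (0:ℝ)..1, f u := by
  rw [intervalIntegral.integral_of_le zero_le_one, integral_Ioc_eq_integral_Ioo, nu]

lemma rpow_val {a : ℝ} (ha : -1 < a) : ∫ u, u ^ a ∂nu = 1 / (a + 1) := by
  rw [nu_int, integral_rpow (Or.inl ha)]
  rw [Real.one_rpow, Real.zero_rpow (by linarith)]; ring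

lemma ftc {f f' : ℝ → ℝ} (hc : ContinuousOn f (Icc 0 1))
    (hd : ∀ u ∈ Ioo (0:ℝ) 1, HasDerivAt f (f' u) u) (hi : Integrable f' nu) :
    ∫ u, f' u ∂nu = f 1 - f 0 := by
  rw [nu_int]
  apply intervalIntegral.integral_eq_sub_of_hasDerivAt_of_le zero_le_one hc hd
  rw [intervalIntegrable_iff_integrableOn_Ioo_of_le zero_le_one]; exact hi

lemma log_cont {a : ℝ} (ha : 0 < a) : ContinuousOn (fun u : ℝ => u ^ a * Real.log u) (Icc 0 1) := by
  intro u hu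
  rcases eq_or_lt_of_le hu.1 with h | h
  · subst h
    have h1 := tendsto_log_mul_rpow_nhdsGT_zero ha
    have : ContinuousWithinAt (fun u : ℝ => u ^ a * Real.log u) (Ioi 0) 0 := by
      simp only [ContinuousWithinAt, Real.log_zero, mul_zero]
      simpa [mul_comm] using h1
    exact (continuousWithinAt_insert_self.2 this).mono (fun x hx => by
      rcases eq_or_lt_of_le hx.1 with h | h
      · exact Or.inl h.symm
      · exact Or.inr h)
  · exact ((Real.continuousAt_rpow_const _ _ (Or.inl h.ne')).mul
      (Real.continuousAt_log h.ne')).continuousWithinAt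

lemma gF_sq_zero : Integrable (fun u => (gF 0 u) ^ 2) nu ∧ ∫ u, (gF 0 u) ^ 2 ∂nu = 1 := by
  have hc : ContinuousOn (fun u : ℝ => (u ^ (1/2:ℝ) * Real.log u) ^ 2 + u) (Icc 0 1) :=
    ((log_cont (by norm_num)).pow 2).add continuousOn_id
  have hc' : ContinuousOn (fun u : ℝ => u * Real.log u ^ 2 + u) (Icc 0 1) := by
    refine hc.congr fun u hu => ?_
    have : (u ^ (1/2:ℝ)) ^ 2 = u := by
      rw [← Real.sqrt_eq_rpow, Real.sq_sqrt hu.1]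
    simp only
    rw [mul_pow, this]
  have hd : ∀ u ∈ Ioo (0:ℝ) 1, HasDerivAt (fun u : ℝ => u * Real.log u ^ 2 + u) ((gF 0 u) ^ 2) u := by
    intro u hu
    have h := (((hasDerivAt_id u).mul ((Real.hasDerivAt_log hu.1.ne').pow 2)).add (hasDerivAt_id u))
    refine hd_congr h rfl ?_
    have := hu.1.ne'
    simp [gF]
    field_simp
    ring
  have hi : Integrable (fun u => (gF 0 u) ^ 2) nu := by
    have := intervalIntegral.integrableOn_deriv_of_nonneg hc' hd (fun u _ => sq_nonneg _)
    exact this.mono_set Ioo_subset_Ioc_self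
  refine ⟨hi, ?_⟩
  rw [ftc hc' hd hi]; simp

lemma gF_sq {s : ℝ} (hs : -(1 / 2 : ℝ) < s) :
    Integrable (fun u => (gF s u) ^ 2) nu ∧ ∫ u, (gF s u) ^ 2 ∂nu = 1 / (2 * s + 1) := by
  by_cases h0 : s = 0
  · subst h0; simpa using gF_sq_zero
  have e : (fun u => (gF s u) ^ 2) =ᵐ[nu] fun u => (1/s^2) * ((s+1)^2 * u ^ (2*s) - 2 * (s+1) * u ^ s + 1) := by
    filter_upwards [ae_restrict_mem measurableSet_Ioo] with u hu
    have : u ^ (2*s) = (u ^ s)^2 := by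
      rw [mul_comm, Real.rpow_mul hu.1.le]; norm_num
    rw [this]; simp only [gF, h0, if_false]; field_simp; ring
  have i1 := (rpow_int (a := 2*s) (by linarith)).const_mul ((s+1)^2)
  have i2 := (rpow_int (a := s) (by linarith)).const_mul (2 * (s+1))
  have i3 : Integrable (fun _ => (1:ℝ)) nu := integrable_const _
  constructor
  · rw [integrable_congr e]
    exact ((i1.sub i2).add i3).const_mul _
  · rw [integral_congr_ae e, integral_const_mul, integral_add (by exact i1.sub i2) i3, integral_sub i1 i2,
      integral_const_mul, integral_const_mul, rpow_val (by linarith), rpow_val (by linarith)]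
    have h2 : 2 * s + 1 ≠ 0 := by linarith
    have h3 : s + 1 ≠ 0 := by linarith
    rw [integral_const, probReal_univ, smul_eq_mul]
    have h4 : (1 / (2 * s + 1)) * (2 * s + 1) = 1 := one_div_mul_cancel h2
    generalize 1 / (2 * s + 1) = p at h4 ⊢
    field_simp
    linear_combination h4

lemma gF_memLp {s : ℝ} (hs : -(1 / 2 : ℝ) < s) : MemLp (gF s) 2 nu :=
  (memLp_two_iff_integrable_sq (meas_gF s).aestronglyMeasurable).2 (gF_sq hs).1

lemma gF_int {s : ℝ} (hs : -(1 / 2 : ℝ) < s) : Integrable (gF s) nu :=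
  (gF_memLp hs).integrable (by norm_num)

lemma phi_cont {s : ℝ} (hs : -(1 / 2 : ℝ) < s) : ContinuousOn (tsallisFn s) (Icc 0 1) := by
  by_cases h0 : s = 0
  · subst h0
    have := (log_cont one_pos).neg
    refine this.congr fun u hu => ?_
    simp [tsallisFn]
  · have : Continuous fun u : ℝ => (1/s) * (u - u ^ (s+1)) := by
      have := Real.continuous_rpow_const (q := s + 1) (by linarith)
      fun_prop
    refine this.continuousOn.congr fun u hu => ?_
    rcases eq_or_lt_of_le hu.1 with h | h
    · subst h
      simp [tsallisFn, Real.zero_rpow (show s + 1 ≠ 0 by linarith)]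
    · simp only [tsallisFn, h0, if_false]
      rw [Real.rpow_add h, Real.rpow_one]; ring

lemma phi_deriv {s : ℝ} {u : ℝ} (hu : 0 < u) : HasDerivAt (tsallisFn s) (-gF s u) u := by
  have hu' := hu.ne'
  by_cases h0 : s = 0
  · subst h0
    have := ((hasDerivAt_id u).mul (Real.hasDerivAt_log hu')).neg
    refine hd_congr this ?_ ?_
    · funext x; simp [tsallisFn]
    · simp [gF]; field_simp; ring
  · have := ((hasDerivAt_id u).mul ((hasDerivAt_const u (1:ℝ)).sub (Real.hasDerivAt_rpow_const (p := s) (Or.inl hu')))).const_mul (1/s)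
    refine hd_congr this ?_ ?_
    · funext x; simp [tsallisFn, h0]
    · simp [gF, h0]
      rw [Real.rpow_sub hu, Real.rpow_one]; field_simp; ring

lemma phi_int {s : ℝ} (hs : -(1 / 2 : ℝ) < s) {t : ℝ} (h0 : 0 ≤ t) (h1 : t ≤ 1) :
    ∫ u in t..1, gF s u = tsallisFn s t := by
  have i : IntervalIntegrable (gF s) volume 0 1 := by
    rw [intervalIntegrable_iff_integrableOn_Ioo_of_le zero_le_one]; exact gF_int hs
  have := intervalIntegral.integral_eq_sub_of_hasDerivAt_of_le h1 
    (((phi_cont hs).mono (Icc_subset_Icc_left h0)).neg)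
    (f' := gF s) (fun u hu => by simpa using (phi_deriv (s := s) (lt_of_le_of_lt h0 hu.1)).neg)
    (i.mono_set (by rw [uIcc_of_le h1, uIcc_of_le zero_le_one]; exact Icc_subset_Icc_left h0))
  rw [this]; simp [tsallisFn]

lemma phi_nonneg {s : ℝ} {t : ℝ} (h0 : 0 ≤ t) (h1 : t ≤ 1) : 0 ≤ tsallisFn s t := by
  rcases eq_or_lt_of_le h0 with h | h
  · subst h; simp [tsallisFn]
  unfold tsallisFn
  split_ifs with hs
  · have := Real.log_nonpos h0 h1
    nlinarith
  · rcases lt_or_gt_of_ne hs with hs | hs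
    · have := Real.one_le_rpow_of_pos_of_le_one_of_nonpos h h1 hs.le
      have h3 : 1 / s < 0 := by simpa using hs
      exact mul_nonneg_of_nonpos_of_nonpos h3.le (by nlinarith)
    · have := Real.rpow_le_one h0 h1 hs.le
      have h3 : 0 < 1 / s := by positivity
      exact mul_nonneg h3.le (mul_nonneg h0 (by linarith))
end TR
namespace TR

/-- Distribution function of the image of the uniform law under `Q`. -/
noncomputable def FF (Q : ℝ → ℝ) (x : ℝ) : ℝ := ((nu.map Q) (Iic x)).toReal

lemma FF_mem {Q : ℝ → ℝ} (hQ : Measurable Q) (x : ℝ) : 0 ≤ FF Q x ∧ FF Q x ≤ 1 := by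
  have : IsProbabilityMeasure (nu.map Q) := Measure.isProbabilityMeasure_map hQ.aemeasurable
  refine ⟨ENNReal.toReal_nonneg, ?_⟩
  exact measureReal_le_one (μ := nu.map Q)

lemma FF_eq {Q : ℝ → ℝ} (hQ : Measurable Q) (x : ℝ) :
    FF Q x = (volume (Q ⁻¹' (Iic x) ∩ Ioo 0 1)).toReal := by
  rw [FF, Measure.map_apply hQ measurableSet_Iic, nu, Measure.restrict_apply (hQ measurableSet_Iic)]

lemma galois {Q : ℝ → ℝ} (hQ : Measurable Q) (hm : MonotoneOn Q (Ioo 0 1)) (x u : ℝ)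
    (hu : u ∈ Ioo (0:ℝ) 1) (hne : u ≠ FF Q x) : x < Q u ↔ FF Q x < u := by
  constructor
  · intro h
    have hsub : Q ⁻¹' (Iic x) ∩ Ioo 0 1 ⊆ Ioc 0 u := by
      rintro v ⟨hv, hv'⟩
      refine ⟨hv'.1, ?_⟩
      by_contra! hc
      have := hm hu hv' hc.le
      simp only [mem_preimage, mem_Iic] at hv
      linarith
    have h2 := ENNReal.toReal_mono (by simp) (measure_mono (μ := volume) hsub)
    rw [← FF_eq hQ] at h2
    simp [hu.1.le] at h2
    exact lt_of_le_of_ne h2 hne.symm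
  · intro h
    by_contra! hc
    have hsub : Ioc 0 u ⊆ Q ⁻¹' (Iic x) ∩ Ioo 0 1 := by
      rintro v ⟨hv, hv'⟩
      have hv1 : v ∈ Ioo (0:ℝ) 1 := ⟨hv, hv'.trans_lt hu.2⟩
      exact ⟨(hm hv1 hu hv').trans hc, hv1⟩
    have hfin : volume (Q ⁻¹' (Iic x) ∩ Ioo 0 1) ≠ ⊤ :=
      measure_ne_top_of_subset inter_subset_right (by simp)
    have h2 := ENNReal.toReal_mono hfin (measure_mono (μ := volume) hsub)
    rw [← FF_eq hQ] at h2
    simp [hu.1.le] at h2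
    linarith

lemma inner_int {s : ℝ} (hs : -(1 / 2 : ℝ) < s) {Q : ℝ → ℝ} (hQ : Measurable Q)
    (hm : MonotoneOn Q (Ioo 0 1)) (x : ℝ) :
    ∫ u, gF s u * hK (Q u) x ∂nu = tsallisFn s (FF Q x) := by
  obtain ⟨h0, h1⟩ := FF_mem hQ x
  have e : (fun u => gF s u * hK (Q u) x) =ᵐ[nu]
      fun u => (Ioc (FF Q x) 1).indicator (gF s) u - (if x < 0 then 1 else 0) * gF s u := by
    have hne : ∀ᵐ u ∂nu, u ≠ FF Q x := by
      refine ae_restrict_of_ae ?_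
      simp [ae_iff]
    filter_upwards [ae_restrict_mem measurableSet_Ioo, hne] with u hu hu'
    have := galois hQ hm x u hu hu'
    simp only [hK, indicator, mem_Ioc, this, hu.2.le, and_true]
    split_ifs <;> ring
  have hg := gF_int hs
  have z : ∫ u, gF s u ∂nu = 0 := by
    rw [nu_int, phi_int hs le_rfl zero_le_one]; simp [tsallisFn]
  rw [integral_congr_ae e, integral_sub (hg.indicator measurableSet_Ioc) (hg.const_mul _),
    integral_const_mul, z, mul_zero, sub_zero, integral_indicator measurableSet_Ioc,
    ← phi_int hs h0 h1, intervalIntegral.integral_of_le h1, nu,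
    Measure.restrict_restrict measurableSet_Ioc]
  have : Ioc (FF Q x) 1 ∩ Ioo 0 1 = Ioo (FF Q x) 1 := by
    ext u; simp only [mem_inter_iff, mem_Ioc, mem_Ioo]; grind
  rw [this, integral_Ioc_eq_integral_Ioo]

lemma main_id {s : ℝ} (hs : -(1 / 2 : ℝ) < s) {Q : ℝ → ℝ} (hQ : Measurable Q)
    (hm : MonotoneOn Q (Ioo 0 1)) (hL : MemLp Q 2 nu) :
    ∫ x, tsallisFn s (FF Q x) = ∫ u, gF s u * Q u ∂nu := by
  simp_rw [← inner_int hs hQ hm]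
  have hgq : Integrable (fun u => gF s u * Q u) nu := (gF_memLp hs).integrable_mul hL
  have hmeas : Measurable (fun p : ℝ × ℝ => gF s p.1 * hK (Q p.1) p.2) := by
    refine ((meas_gF s).comp measurable_fst).mul (Measurable.sub ?_ ?_)
    · exact Measurable.ite (measurableSet_lt measurable_snd (hQ.comp measurable_fst))
        measurable_const measurable_const
    · exact Measurable.ite (measurableSet_lt measurable_snd measurable_const)
        measurable_const measurable_const
  have hint : Integrable (fun p : ℝ × ℝ => gF s p.1 * hK (Q p.1) p.2) (nu.prod volume) := by
    rw [integrable_prod_iff hmeas.aestronglyMeasurable]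
    refine ⟨Filter.Eventually.of_forall fun u => (hK_int (Q u)).const_mul (gF s u), ?_⟩
    have : (fun u => ∫ x, ‖gF s u * hK (Q u) x‖) = fun u => ‖gF s u * Q u‖ := by
      funext u
      simp_rw [norm_mul]
      rw [integral_const_mul, hK_absval, Real.norm_eq_abs (Q u)]
    exact this ▸ hgq.norm
  rw [← integral_integral_swap (f := fun u x => gF s u * hK (Q u) x) hint]
  simp_rw [integral_const_mul, hK_val]

lemma mVar_map {Q : ℝ → ℝ} (hQ : Measurable Q) :
    mVar (nu.map Q) = ∫ u, (Q u - ∫ v, Q v ∂nu) ^ 2 ∂nu := by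
  have h1 : ∫ y, y ∂(nu.map Q) = ∫ v, Q v ∂nu :=
    integral_map hQ.aemeasurable (by fun_prop)
  unfold mVar
  rw [h1, integral_map hQ.aemeasurable (by fun_prop)]

lemma bound {s : ℝ} (hs : -(1 / 2 : ℝ) < s) {Q : ℝ → ℝ} (hQ : Measurable Q)
    (hL : MemLp Q 2 nu) :
    ∫ u, gF s u * Q u ∂nu ≤ Real.sqrt (mVar (nu.map Q)) / Real.sqrt (2 * s + 1) := by
  have hc : 0 < 2 * s + 1 := by linarith
  rw [mVar_map hQ, ← Real.sqrt_div' _ hc.le]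
  apply Real.le_sqrt_of_sq_le
  set m := ∫ v, Q v ∂nu
  set I := ∫ u, gF s u * Q u ∂nu with hI
  have hg := gF_int hs
  have hgq : Integrable (fun u => gF s u * Q u) nu := (gF_memLp hs).integrable_mul hL
  have z : ∫ u, gF s u ∂nu = 0 := by
    rw [nu_int, phi_int hs le_rfl zero_le_one]; simp [tsallisFn]
  have hLm : MemLp (fun u => Q u - m) 2 nu := hL.sub (memLp_const m)
  have i1 : Integrable (fun u => (Q u - m)^2) nu := hLm.integrable_sq
  set t := I * (2 * s + 1) with ht
  have i2 : Integrable (fun u => 2 * t * (gF s u * Q u)) nu := hgq.const_mul _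
  have i3 : Integrable (fun u => 2 * t * m * gF s u) nu := hg.const_mul _
  have i4 : Integrable (fun u => t^2 * gF s u ^ 2) nu := (gF_sq hs).1.const_mul _
  have key : 0 ≤ ∫ u, ((Q u - m) - t * gF s u)^2 ∂nu := integral_nonneg fun u => sq_nonneg _
  have e : ∀ u, ((Q u - m) - t * gF s u)^2 =
      (Q u - m)^2 - 2 * t * (gF s u * Q u) + 2 * t * m * gF s u + t^2 * gF s u ^ 2 := by
    intro u; ring
  simp_rw [e] at key
  rw [integral_add (by exact (i1.sub i2).add i3) i4, integral_add (by exact i1.sub i2) i3, integral_sub i1 i2,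
    integral_const_mul, integral_const_mul, integral_const_mul, z, (gF_sq hs).2, ← hI] at key
  rw [le_div_iff₀ hc]
  have : t ^ 2 * (1 / (2 * s + 1)) = I^2 * (2 * s + 1) := by rw [ht]; field_simp
  rw [this] at key
  rw [ht] at key
  nlinarith

/-- Quantile function. -/
noncomputable def qF (μ : Measure ℝ) (u : ℝ) : ℝ :=
  if u ∈ Ioo (0:ℝ) 1 then sInf {x | u ≤ ProbabilityTheory.cdf μ x} else 0

lemma qF_le (μ : Measure ℝ) {u : ℝ} (hu : u ∈ Ioo (0:ℝ) 1) (x : ℝ) :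
    qF μ u ≤ x ↔ u ≤ ProbabilityTheory.cdf μ x := by
  set S := {x | u ≤ ProbabilityTheory.cdf μ x} with hS
  have hmono := ProbabilityTheory.monotone_cdf μ
  have hne : S.Nonempty := by
    have := (ProbabilityTheory.tendsto_cdf_atTop μ).eventually (eventually_gt_nhds hu.2)
    obtain ⟨x, hx⟩ := this.exists
    exact ⟨x, le_of_lt hx⟩
  have hbdd : BddBelow S := by
    have := (ProbabilityTheory.tendsto_cdf_atBot μ).eventually (eventually_lt_nhds hu.1)
    obtain ⟨b, hb⟩ := this.exists
    refine ⟨b, fun y hy => ?_⟩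
    by_contra! hc
    have := hmono hc.le
    simp only [hS, mem_ofPred_eq] at hy
    linarith
  simp only [qF, hu, if_true]
  constructor
  · intro h
    have hr := (ProbabilityTheory.cdf μ).right_continuous x
    have hr' : Filter.Tendsto (ProbabilityTheory.cdf μ) (nhdsWithin x (Ioi x)) (nhds (ProbabilityTheory.cdf μ x)) :=
      hr.tendsto.mono_left (nhdsWithin_mono _ Ioi_subset_Ici_self)
    refine ge_of_tendsto hr' ?_
    filter_upwards [self_mem_nhdsWithin] with y hy
    obtain ⟨w, hw, hwy⟩ := exists_lt_of_csInf_lt hne (lt_of_le_of_lt h hy)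
    exact le_trans hw (hmono hwy.le)
  · intro h
    exact csInf_le hbdd h

lemma qF_mono (μ : Measure ℝ) : MonotoneOn (qF μ) (Ioo 0 1) := by
  intro u hu v hv huv
  rw [qF_le μ hu]
  exact huv.trans ((qF_le μ hv _).1 le_rfl)

lemma qF_meas (μ : Measure ℝ) : Measurable (qF μ) := by
  refine measurable_of_Iic fun x => ?_
  have : qF μ ⁻¹' Iic x = (Ioo 0 1 ∩ Iic (ProbabilityTheory.cdf μ x)) ∪ ((Ioo 0 1)ᶜ ∩ {_u | 0 ≤ x}) := by
    ext u
    by_cases hu : u ∈ Ioo (0:ℝ) 1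
    · simp only [mem_preimage, mem_Iic, qF_le μ hu, mem_union, mem_inter_iff, hu, mem_compl_iff]; simp
    · simp only [mem_preimage, mem_Iic, qF, hu, mem_union, mem_inter_iff, mem_compl_iff]; simp
  rw [this]
  measurability

lemma qF_map (μ : Measure ℝ) [IsProbabilityMeasure μ] : nu.map (qF μ) = μ := by
  have : IsProbabilityMeasure (nu.map (qF μ)) :=
    Measure.isProbabilityMeasure_map (qF_meas μ).aemeasurable
  refine Measure.ext_of_Iic _ _ fun x => ?_
  rw [Measure.map_apply (qF_meas μ) measurableSet_Iic, nu,
    Measure.restrict_apply (qF_meas μ measurableSet_Iic)]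
  have h1 := ProbabilityTheory.cdf_le_one μ x
  have h0 := ProbabilityTheory.cdf_nonneg μ x
  have : qF μ ⁻¹' Iic x ∩ Ioo 0 1 = Ioo 0 1 ∩ Iic (ProbabilityTheory.cdf μ x) := by
    ext u
    by_cases hu : u ∈ Ioo (0:ℝ) 1
    · simp only [mem_preimage, mem_Iic, qF_le μ hu, mem_inter_iff, hu]; simp
    · simp [hu]
  rw [this]
  have e : volume (Ioo 0 1 ∩ Iic (ProbabilityTheory.cdf μ x)) = ENNReal.ofReal (ProbabilityTheory.cdf μ x) := by
    apply le_antisymm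
    · refine (measure_mono (t := Icc 0 (ProbabilityTheory.cdf μ x)) ?_).trans (by simp)
      rintro u ⟨hu, hu'⟩
      exact ⟨hu.1.le, hu'⟩
    · refine le_trans (by simp) (measure_mono (s := Ioo 0 (ProbabilityTheory.cdf μ x)) ?_)
      rintro u ⟨hu, hu'⟩
      exact ⟨⟨hu, hu'.trans_le h1⟩, hu'.le⟩
  rw [e, ProbabilityTheory.ofReal_cdf]

lemma upper {s : ℝ} (hs : -(1 / 2 : ℝ) < s) (μ : Measure ℝ) [IsProbabilityMeasure μ]
    (h2 : Integrable (fun x : ℝ => x ^ 2) μ) :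
    (∫ x : ℝ, tsallisFn s ((μ (Iic x)).toReal)) ≤ Real.sqrt (mVar μ) / Real.sqrt (2 * s + 1) := by
  have hm := qF_meas μ
  have hL : MemLp (qF μ) 2 nu := by
    rw [memLp_two_iff_integrable_sq hm.aestronglyMeasurable]
    rw [← qF_map μ] at h2
    exact (integrable_map_measure (by fun_prop) hm.aemeasurable).1 h2
  have h := main_id hs hm (qF_mono μ) hL
  have hb := bound hs hm hL
  unfold FF at h
  rw [qF_map] at h hb
  rw [h]; exact hb

lemma rl_zero {a : ℝ} (ha : -(1/2) < a) (hi : Integrable (fun u => gF 0 u * u ^ a) nu) :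
    ∫ u, gF 0 u * u ^ a ∂nu = a / (a + 1) ^ 2 := by
  have ha1 : a + 1 ≠ 0 := by linarith
  have hc : ContinuousOn (fun u : ℝ => (1/(a+1)) * (u ^ (a+1) * Real.log u) + (a/(a+1)^2) * u ^ (a+1)) (Icc 0 1) := by
    have h1 := log_cont (a := a + 1) (by linarith)
    have h2 := (Real.continuous_rpow_const (q := a + 1) (by linarith)).continuousOn (s := Icc 0 1)
    exact (h1.const_mul _).add (h2.const_mul _)
  rw [ftc hc ?_ hi]
  · simp [Real.zero_rpow ha1]
  · intro u hu
    have hu' := hu.1.ne'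
    have hr := Real.hasDerivAt_rpow_const (x := u) (p := a + 1) (Or.inl hu')
    refine hd_congr (((hr.mul (Real.hasDerivAt_log hu')).const_mul _).add (hr.const_mul _)) rfl ?_
    simp only [gF, if_true]
    rw [show a + 1 - 1 = a by ring, Real.rpow_add hu.1, Real.rpow_one]
    field_simp
    ring

lemma rpow_memLp {a : ℝ} (ha : -(1/2) < a) : MemLp (fun u : ℝ => u ^ a) 2 nu := by
  rw [memLp_two_iff_integrable_sq (by fun_prop)]
  refine (rpow_int (a := 2 * a) (by linarith)).congr ?_
  filter_upwards [ae_restrict_mem measurableSet_Ioo] with u hu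
  rw [mul_comm, Real.rpow_mul hu.1.le]; norm_num

lemma rl_val {s a : ℝ} (hs : -(1 / 2 : ℝ) < s) (ha : -(1/2) < a) :
    ∫ u, gF s u * u ^ a ∂nu = a / ((a + 1) * (a + 1 + s)) := by
  have hi : Integrable (fun u => gF s u * u ^ a) nu := (gF_memLp hs).integrable_mul (rpow_memLp ha)
  by_cases h0 : s = 0
  · subst h0; rw [rl_zero ha hi]; ring
  have e : (fun u => gF s u * u ^ a) =ᵐ[nu] fun u => (1/s) * ((s+1) * u ^ (s + a) - u ^ a) := by
    filter_upwards [ae_restrict_mem measurableSet_Ioo] with u hu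
    rw [Real.rpow_add hu.1]; simp only [gF, h0, if_false]; ring
  have i1 := (rpow_int (a := s + a) (by linarith)).const_mul (s+1)
  have i2 := (rpow_int (a := a) (by linarith))
  rw [integral_congr_ae e, integral_const_mul, integral_sub i1 i2,
      integral_const_mul, rpow_val (by linarith), rpow_val (by linarith)]
  have : a + 1 + s ≠ 0 := by linarith
  have : s + a + 1 ≠ 0 := by linarith
  have : a + 1 ≠ 0 := by linarith
  field_simp
  ring

lemma var_val {a e : ℝ} (ha : -(1/2) < a) (he : e ^ 2 = 1) :
    mVar (nu.map (fun u : ℝ => e * u ^ a)) = a ^ 2 / ((2 * a + 1) * (a + 1) ^ 2) := by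
  rw [mVar_map (by fun_prop), integral_const_mul, rpow_val (by linarith)]
  have hsq := (rpow_memLp ha).integrable_sq
  have hv : ∫ u, (u ^ a) ^ 2 ∂nu = 1 / (2 * a + 1) := by
    rw [← rpow_val (by linarith)]
    refine integral_congr_ae ?_
    filter_upwards [ae_restrict_mem measurableSet_Ioo] with u hu
    rw [mul_comm 2 a, Real.rpow_mul hu.1.le]; norm_num
  have e1 : ∀ u : ℝ, (e * u ^ a - e * (1 / (a + 1))) ^ 2 =
      (u ^ a) ^ 2 - (2 / (a + 1)) * u ^ a + (1 / (a + 1)) ^ 2 := by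
    intro u
    have : (e * u ^ a - e * (1 / (a + 1))) ^ 2 = e ^ 2 * (u ^ a - 1 / (a+1)) ^ 2 := by ring
    rw [this, he]; ring
  simp_rw [e1]
  have i2 := (rpow_int (a := a) (by linarith)).const_mul (2 / (a+1))
  rw [integral_add (by exact hsq.sub i2) (integrable_const _), integral_sub hsq i2, integral_const_mul, hv,
    rpow_val (by linarith)]
  have : a + 1 ≠ 0 := by linarith
  have : 2 * a + 1 ≠ 0 := by linarith
  simp
  field_simp
  ring

lemma attain {s a e : ℝ} (hs : -(1 / 2 : ℝ) < s) (ha : -(1/2) < a) (he : e ^ 2 = 1)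
    (hea : 0 < e * a) : ∃ μ : Measure ℝ, IsProbabilityMeasure μ ∧
        Integrable (fun x : ℝ => x ^ 2) μ ∧ 0 < Real.sqrt (mVar μ) ∧
        Real.sqrt (2 * a + 1) / (a + 1 + s) = (∫ x : ℝ, tsallisFn s ((μ (Iic x)).toReal)) / Real.sqrt (mVar μ) := by
  have hQ : Measurable (fun u : ℝ => e * u ^ a) := by fun_prop
  have hL : MemLp (fun u : ℝ => e * u ^ a) 2 nu := (rpow_memLp ha).const_mul e
  have ha0 : a ≠ 0 := by rintro rfl; simp at hea
  have hm : MonotoneOn (fun u : ℝ => e * u ^ a) (Ioo 0 1) := by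
    intro u hu v hv huv
    simp only
    rcases lt_or_gt_of_ne ha0 with h | h
    · have : e < 0 := by nlinarith
      exact mul_le_mul_of_nonpos_left (Real.rpow_le_rpow_of_nonpos hu.1 huv h.le) this.le
    · have : 0 < e := by nlinarith
      exact mul_le_mul_of_nonneg_left (Real.rpow_le_rpow hu.1.le huv h.le) this.le
  have hid := main_id hs hQ hm hL
  have h1 : 0 < a + 1 := by linarith
  have h2 : 0 < 2 * a + 1 := by linarith
  have h3 : 0 < a + 1 + s := by linarith
  have hw : 0 < Real.sqrt (2 * a + 1) := Real.sqrt_pos.2 h2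
  have hsd : Real.sqrt (mVar (nu.map (fun u : ℝ => e * u ^ a))) = e * a / (Real.sqrt (2 * a + 1) * (a + 1)) := by
    rw [var_val ha he]
    rw [Real.sqrt_eq_iff_mul_self_eq (by positivity) (by positivity)]
    have := Real.sq_sqrt h2.le
    have hh : (e * a / (Real.sqrt (2 * a + 1) * (a + 1))) * (e * a / (Real.sqrt (2 * a + 1) * (a + 1)))
      = e ^ 2 * a ^ 2 / (Real.sqrt (2 * a + 1) ^ 2 * (a + 1) ^ 2) := by
      field_simp
    rw [hh, this, he, one_mul]
  refine ⟨nu.map (fun u : ℝ => e * u ^ a), Measure.isProbabilityMeasure_map hQ.aemeasurable, ?_, ?_, ?_⟩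
  · exact (integrable_map_measure (by fun_prop) hQ.aemeasurable).2 hL.integrable_sq
  · rw [hsd]; positivity
  · have hid' : (∫ x : ℝ, tsallisFn s (((nu.map (fun u : ℝ => e * u ^ a)) (Iic x)).toReal)) =
        e * (a / ((a + 1) * (a + 1 + s))) := by
      rw [← rl_val hs ha, ← integral_const_mul]
      refine hid.trans (integral_congr_ae (Filter.Eventually.of_forall fun u => ?_))
      simp only; ring
    rw [hid', hsd]
    have : e ≠ 0 := by rintro rfl; simp at hea
    field_simp

lemma param {s r : ℝ} (hs : -(1 / 2 : ℝ) < s) (hr : r ∈ Ioo 0 (1 / Real.sqrt (2 * s + 1))) :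
    ∃ a e : ℝ, -(1/2) < a ∧ e ^ 2 = 1 ∧ 0 < e * a ∧ Real.sqrt (2 * a + 1) / (a + 1 + s) = r := by
  obtain ⟨hr0, hr1⟩ := hr
  have h2 : 0 < 2 * s + 1 := by linarith
  set c := Real.sqrt (2 * s + 1) with hc
  have hcp : 0 < c := Real.sqrt_pos.2 h2
  have hc2 : c ^ 2 = 2 * s + 1 := Real.sq_sqrt h2.le
  have hrc : r * c < 1 := by rwa [lt_div_iff₀ hcp] at hr1
  have hrc0 : 0 < r * c := by positivity
  have hD : 0 < 1 - (r * c) ^ 2 := by nlinarith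
  set d := Real.sqrt (1 - (r * c) ^ 2) with hd
  have hdp : 0 < d := Real.sqrt_pos.2 hD
  have hd2 : d ^ 2 = 1 - (r * c) ^ 2 := Real.sq_sqrt hD.le
  have fin : ∀ w : ℝ, 0 < w → r * w ^ 2 - 2 * w + r * c ^ 2 = 0 →
      Real.sqrt (2 * ((w ^ 2 - 1) / 2) + 1) / ((w ^ 2 - 1) / 2 + 1 + s) = r := by
    intro w hw h
    rw [show 2 * ((w ^ 2 - 1) / 2) + 1 = w ^ 2 by ring, Real.sqrt_sq hw.le,
      show (w ^ 2 - 1) / 2 + 1 + s = (w ^ 2 + c ^ 2) / 2 by rw [hc2]; ring]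
    rw [div_eq_iff (by positivity)]
    linarith
  rcases le_or_gt 0 s with h | h
  · set w := (1 + d) / r with hw
    have hwr : w * r = 1 + d := by rw [hw]; field_simp
    have hwp : 0 < w := by positivity
    have hc1 : 1 ≤ c := by nlinarith
    have hwc : c < w := by
      by_contra! hcon
      nlinarith
    refine ⟨(w ^ 2 - 1) / 2, 1, by nlinarith, by norm_num, by nlinarith, fin w hwp ?_⟩
    have : r * (r * w ^ 2 - 2 * w + r * c ^ 2) = 0 := by
      have : r * (r * w ^ 2 - 2 * w + r * c ^ 2) = (w * r) ^ 2 - 2 * (w * r) + (r * c) ^ 2 := by ring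
      rw [this, hwr]; nlinarith
    exact (mul_eq_zero.1 this).resolve_left hr0.ne'
  · have hd1 : d < 1 := by nlinarith
    set w := (1 - d) / r with hw
    have hwr : w * r = 1 - d := by rw [hw]; field_simp
    have hwp : 0 < w := div_pos (by linarith) hr0
    have hc1 : c < 1 := by nlinarith
    have hwc : w < c := by
      by_contra! hcon
      have : r * c ≤ 1 - d := by rw [← hwr]; nlinarith
      nlinarith
    refine ⟨(w ^ 2 - 1) / 2, -1, by nlinarith, by norm_num, by nlinarith, fin w hwp ?_⟩
    have : r * (r * w ^ 2 - 2 * w + r * c ^ 2) = 0 := by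
      have : r * (r * w ^ 2 - 2 * w + r * c ^ 2) = (w * r) ^ 2 - 2 * (w * r) + (r * c) ^ 2 := by ring
      rw [this, hwr]; nlinarith
    exact (mul_eq_zero.1 this).resolve_left hr0.ne'

end TR

/-- **Proposition CumRan.** For every `s > −1/2`, the closure of the set of
ratios `Δ_s(X)/σ_X` over square-integrable random variables `X` (identified with their laws
`μ` on `ℝ`) with `σ_X > 0` equals `[0, 1/√(2s+1)]`; in particular
`Δ_s(X) ≤ σ_X/√(2s+1)` for every square-integrable `X`. -/
theorem tsallis_range_L2 (s : ℝ) (hs : -(1 / 2 : ℝ) < s) :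
    closure {r : ℝ | ∃ μ : Measure ℝ, IsProbabilityMeasure μ ∧
        Integrable (fun x : ℝ => x ^ 2) μ ∧ 0 < Real.sqrt (mVar μ) ∧
        r = (∫ x : ℝ, tsallisFn s ((μ (Iic x)).toReal)) / Real.sqrt (mVar μ)}
      = Icc (0 : ℝ) (1 / Real.sqrt (2 * s + 1))
    ∧ ∀ μ : Measure ℝ, IsProbabilityMeasure μ → Integrable (fun x : ℝ => x ^ 2) μ →
        (∫ x : ℝ, tsallisFn s ((μ (Iic x)).toReal))
          ≤ Real.sqrt (mVar μ) / Real.sqrt (2 * s + 1) := by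

  have hcp : 0 < Real.sqrt (2 * s + 1) := Real.sqrt_pos.2 (by linarith)
  refine ⟨?_, fun μ hμ h2 => TR.upper hs μ h2⟩
  apply Subset.antisymm
  · refine closure_minimal ?_ isClosed_Icc
    rintro r ⟨μ, hμ, h2, hv, rfl⟩
    constructor
    · refine div_nonneg (integral_nonneg fun x => ?_) hv.le
      exact TR.phi_nonneg ENNReal.toReal_nonneg (measureReal_le_one (μ := μ))
    · rw [div_le_iff₀ hv]
      refine (TR.upper hs μ h2).trans (le_of_eq ?_)
      ring
  · rw [← closure_Ioo (by positivity : (0:ℝ) ≠ 1 / Real.sqrt (2 * s + 1)).symm.symm]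
    refine closure_mono fun r hr => ?_
    obtain ⟨a, e, ha, he, hea, hr'⟩ := TR.param hs hr
    rw [← hr']
    exact TR.attain hs ha he hea
end

section
/- For every s ∈ (−1/2,0) ∪ (0,∞), the closure in ℝ of the set { Δ_s(X)/σ_X : X a square-integrable real random variable with σ_X > 0 such that X and −X have the same distribution } equals the interval [0, M_s], where M_s = ((s+1)/√(2 s² (2s+1))) · √(1 − Γ(s+1)²/Γ(2s+1)) and Γ is the Gamma function. In particular, for every symmetric square-integrable X, Δ_s(X) ≤ M_s · σ_X, and this bound is attained by X = (1−U)^s − U^s with U uniform on (0,1). -/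
open MeasureTheory Set

/-- Uniform law on `(0,1)`. -/
noncomputable def nuU : Measure ℝ := (volume : Measure ℝ).restrict (Ioo (0 : ℝ) 1)

instance nuU_prob : IsProbabilityMeasure nuU := ⟨by simp [nuU]⟩

lemma mp_refl : MeasurePreserving (fun u : ℝ => 1 - u) nuU nuU := by
  have h := (Measure.measurePreserving_sub_left (volume : Measure ℝ) 1).restrict_preimage
    (measurableSet_Ioo (a := (0 : ℝ)) (b := 1))
  have e : (fun x : ℝ => 1 - x) ⁻¹' Ioo (0 : ℝ) 1 = Ioo 0 1 := by
    ext x; simp only [mem_preimage, mem_Ioo]; constructor <;> rintro ⟨a, b⟩ <;> constructor <;> linarith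
  rw [e] at h
  exact h

lemma me_refl : MeasurableEmbedding (fun u : ℝ => 1 - u) :=
  (MeasurableEquiv.subLeft (1 : ℝ)).measurableEmbedding

lemma int_refl (f : ℝ → ℝ) : ∫ u, f (1 - u) ∂nuU = ∫ u, f u ∂nuU :=
  mp_refl.integral_comp me_refl f

lemma ae_mem : ∀ᵐ u ∂nuU, u ∈ Ioo (0 : ℝ) 1 := ae_restrict_mem measurableSet_Ioo

lemma cs_ineq {f g : ℝ → ℝ} (hf : MemLp f 2 nuU) (hg : MemLp g 2 nuU) :
    |∫ u, f u * g u ∂nuU| ≤ Real.sqrt (∫ u, f u ^ 2 ∂nuU) * Real.sqrt (∫ u, g u ^ 2 ∂nuU) := by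
  have h := integral_mul_norm_le_Lp_mul_Lq (μ := nuU) (f := f) (g := g)
    (Real.HolderConjugate.two_two) (by simpa using hf) (by simpa using hg)
  have h2 : |∫ u, f u * g u ∂nuU| ≤ ∫ u, ‖f u‖ * ‖g u‖ ∂nuU := by
    have := norm_integral_le_integral_norm (μ := nuU) (fun u => f u * g u)
    simpa [norm_mul] using this
  refine h2.trans (h.trans (le_of_eq ?_))
  simp [Real.sqrt_eq_rpow]

/-- Integration of `1_{x<q} - 1_{x<0}`. -/
noncomputable def stp (q x : ℝ) : ℝ := (if x < q then 1 else 0) - (if x < 0 then 1 else 0)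

lemma stp_eq (q : ℝ) : stp q = (Ico 0 q).indicator (fun _ => (1 : ℝ)) - (Ico q 0).indicator (fun _ => (1 : ℝ)) := by
  funext x
  simp only [stp, Pi.sub_apply, indicator, mem_Ico]
  split_ifs <;> first | grind | norm_num

lemma stp_abs (q : ℝ) : (fun x => ‖stp q x‖) = (Ico 0 q).indicator (fun _ => (1 : ℝ)) + (Ico q 0).indicator (fun _ => (1 : ℝ)) := by
  funext x
  simp only [stp, Pi.add_apply, indicator, mem_Ico]
  split_ifs <;> first | grind | norm_num

lemma ind_int (a b : ℝ) : Integrable ((Ico a b).indicator (fun _ => (1 : ℝ))) volume :=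
  (integrable_indicator_iff measurableSet_Ico).2 (integrableOn_const (by simp) (by simp))

lemma stp_integrable (q : ℝ) : Integrable (stp q) volume := by
  rw [stp_eq]; exact (ind_int _ _).sub (ind_int _ _)

lemma stp_integral (q : ℝ) : ∫ x, stp q x = q := by
  rw [stp_eq, integral_sub' (ind_int _ _) (ind_int _ _)]
  rw [integral_indicator measurableSet_Ico, integral_indicator measurableSet_Ico]
  simp

lemma stp_integral_abs (q : ℝ) : ∫ x, ‖stp q x‖ = |q| := by
  rw [stp_abs, integral_add' (ind_int _ _) (ind_int _ _)]
  rw [integral_indicator measurableSet_Ico, integral_indicator measurableSet_Ico]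
  simp

lemma fubini_stp {k Q : ℝ → ℝ} (hk : Measurable k) (hQ : Measurable Q)
    (hkQ : Integrable (fun p => k p * Q p) nuU) :
    ∫ x, ∫ p, k p * stp (Q p) x ∂nuU = ∫ p, k p * Q p ∂nuU := by
  have hm : Measurable (Function.uncurry (fun x p : ℝ => k p * stp (Q p) x)) := by
    unfold stp Function.uncurry
    refine (hk.comp measurable_snd).mul (Measurable.sub ?_ ?_)
    · exact Measurable.ite (measurableSet_lt measurable_fst (hQ.comp measurable_snd))
        measurable_const measurable_const
    · exact Measurable.ite (measurableSet_lt measurable_fst measurable_const)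
        measurable_const measurable_const
  have hint : Integrable (Function.uncurry (fun x p : ℝ => k p * stp (Q p) x))
      ((volume : Measure ℝ).prod nuU) := by
    rw [integrable_prod_iff' hm.aestronglyMeasurable]
    constructor
    · exact Filter.Eventually.of_forall fun p => (stp_integrable (Q p)).const_mul (k p)
    · simp only [Function.uncurry, norm_mul, integral_const_mul, stp_integral_abs]
      simpa [norm_mul] using hkQ.norm
  rw [integral_integral_swap hint]
  simp [integral_const_mul, stp_integral]

/-- Sub-level sets of monotone functions are a.e. intervals. -/
lemma sublevel_ae {Q : ℝ → ℝ} (hQ : Measurable Q) (hmono : MonotoneOn Q (Ioo 0 1)) (x : ℝ) :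
    (Q ⁻¹' Iic x ∩ Ioo 0 1 : Set ℝ) =ᵐ[volume]
      Ioc 0 ((Measure.map Q nuU (Iic x)).toReal) := by
  have hv : Measure.map Q nuU (Iic x) = volume (Q ⁻¹' Iic x ∩ Ioo 0 1) := by
    rw [Measure.map_apply hQ measurableSet_Iic, nuU,
      Measure.restrict_apply (hQ measurableSet_Iic)]
  have hfin : volume (Q ⁻¹' Iic x ∩ Ioo (0 : ℝ) 1) ≠ ⊤ :=
    ne_top_of_le_ne_top (by simp) (measure_mono (inter_subset_right (s := Q ⁻¹' Iic x) (t := Ioo (0 : ℝ) 1)))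
  rw [hv]
  apply ae_eq_of_subset_of_measure_ge
  · rintro p ⟨hp, hp0, hp1⟩
    refine ⟨hp0, ?_⟩
    have hsub : Ioc 0 p ⊆ Q ⁻¹' Iic x ∩ Ioo 0 1 := by
      rintro y ⟨hy0, hy1⟩
      have hy : y ∈ Ioo (0 : ℝ) 1 := ⟨hy0, hy1.trans_lt hp1⟩
      exact ⟨(hmono hy ⟨hp0, hp1⟩ hy1).trans hp, hy⟩
    have := ENNReal.toReal_mono hfin (measure_mono (μ := volume) hsub)
    simpa [hp0.le] using this
  · rw [Real.volume_Ioc, sub_zero, ENNReal.ofReal_toReal hfin]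
  · exact ((hQ measurableSet_Iic).inter measurableSet_Ioo).nullMeasurableSet
  · simp

/-- The kernel, `-φ'`. -/
noncomputable def ker (s p : ℝ) : ℝ := ((s + 1) * p ^ s - 1) / s

lemma ker_meas (s : ℝ) : Measurable (ker s) := by unfold ker; fun_prop

lemma pow_memLp {s : ℝ} (hs : -(1/2) < s) : MemLp (fun p : ℝ => p ^ s) 2 nuU := by
  rw [memLp_two_iff_integrable_sq (by fun_prop)]
  have h : IntegrableOn (fun p : ℝ => p ^ (2 * s)) (Ioo 0 1) volume :=
    (intervalIntegral.integrableOn_Ioo_rpow_iff one_pos).2 (by linarith)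
  refine (integrable_congr ?_).1 h
  filter_upwards [ae_mem] with p hp
  rw [mul_comm, Real.rpow_mul hp.1.le]; norm_cast

lemma pow_memLp' {s : ℝ} (hs : -(1/2) < s) : MemLp (fun p : ℝ => (1 - p) ^ s) 2 nuU :=
  (pow_memLp hs).comp_measurePreserving mp_refl

lemma ker_memLp {s : ℝ} (hs : -(1/2) < s) : MemLp (ker s) 2 nuU := by
  have := (((pow_memLp hs).const_mul (s + 1)).sub (memLp_const (1 : ℝ))).const_mul (1 / s)
  refine this.ae_eq (Filter.Eventually.of_forall fun p => ?_)
  simp [ker]; ring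

lemma ker_int {s t : ℝ} (hs : -(1/2) < s) (hs0 : s ≠ 0) (ht0 : 0 ≤ t) :
    ∫ p in Ioc 0 t, ker s p = - tsallisFn s t := by
  rw [← intervalIntegral.integral_of_le ht0]
  simp only [ker, intervalIntegral.integral_div]
  rw [intervalIntegral.integral_sub
    ((intervalIntegral.intervalIntegrable_rpow' (by linarith)).const_mul _) (by simp),
    intervalIntegral.integral_const_mul, integral_rpow (Or.inl (by linarith))]
  have h1 : s + 1 ≠ 0 := by linarith
  rw [Real.zero_rpow h1, tsallisFn, if_neg hs0, Real.rpow_add_one' ht0 h1]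
  simp
  field_simp
  ring

lemma core {s : ℝ} (hs : -(1/2) < s) (hs0 : s ≠ 0) {Q : ℝ → ℝ} (hQ : Measurable Q)
    (hmono : MonotoneOn Q (Ioo 0 1)) (hL : MemLp Q 2 nuU) :
    ∫ x : ℝ, tsallisFn s ((Measure.map Q nuU (Iic x)).toReal) = ∫ p, ker s p * Q p ∂nuU := by
  rw [← fubini_stp (ker_meas s) hQ ((ker_memLp hs).integrable_mul hL)]
  congr 1
  funext x
  have hki : Integrable (ker s) nuU := (ker_memLp hs).integrable (by norm_num)
  have hk0 : ∫ p, ker s p ∂nuU = 0 := by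
    rw [nuU, ← integral_Ioc_eq_integral_Ioo, ker_int hs hs0 zero_le_one]
    simp [tsallisFn]
  have e : ∀ p, ker s p * stp (Q p) x =
      ker s p * (1 - if x < 0 then 1 else 0) - (Q ⁻¹' Iic x).indicator (ker s) p := by
    intro p
    by_cases h : x < Q p
    · have : p ∉ Q ⁻¹' Iic x := by simpa using h
      simp [stp, h, this]
    · have : p ∈ Q ⁻¹' Iic x := by simpa using h
      simp only [stp, h, indicator_of_mem this, if_false]; ring
  simp only [e]
  rw [integral_sub (hki.mul_const _) (hki.indicator (hQ measurableSet_Iic)), integral_mul_const,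
    hk0, integral_indicator (hQ measurableSet_Iic)]
  conv_rhs => rw [nuU, Measure.restrict_restrict (hQ measurableSet_Iic)]
  rw [setIntegral_congr_set (sublevel_ae hQ hmono x), ker_int hs hs0 ENNReal.toReal_nonneg]
  ring

/-- The odd kernel. -/
noncomputable def hh (s p : ℝ) : ℝ := p ^ s - (1 - p) ^ s

lemma hh_meas (s : ℝ) : Measurable (hh s) := by unfold hh; fun_prop

lemma hh_memLp {s : ℝ} (hs : -(1/2) < s) : MemLp (hh s) 2 nuU := (pow_memLp hs).sub (pow_memLp' hs)

lemma core_sym {s : ℝ} (hs : -(1/2) < s) (hs0 : s ≠ 0) {Q : ℝ → ℝ} (hQ : Measurable Q)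
    (hmono : MonotoneOn Q (Ioo 0 1)) (hL : MemLp Q 2 nuU)
    (hsym : Measure.map (fun x : ℝ => -x) (Measure.map Q nuU) = Measure.map Q nuU) :
    ∫ x : ℝ, tsallisFn s ((Measure.map Q nuU (Iic x)).toReal)
      = (s + 1) / (2 * s) * ∫ p, hh s p * Q p ∂nuU := by
  have h1 := core hs hs0 hQ hmono hL
  set Q2 : ℝ → ℝ := fun p => -Q (1 - p) with hQ2
  have hQ2m : Measurable Q2 := by fun_prop
  have hmap : Measure.map Q2 nuU = Measure.map Q nuU := by
    rw [← hsym, Measure.map_map (by fun_prop) hQ]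
    conv_rhs => rw [← mp_refl.map_eq]
    rw [Measure.map_map (by fun_prop) (by fun_prop)]
    rfl
  have h2 := core hs hs0 hQ2m (by
    intro a ha b hb hab
    simp only [hQ2]
    have := hmono (a := 1 - b) (b := 1 - a) ⟨by linarith [hb.2], by linarith [hb.1]⟩
      ⟨by linarith [ha.2], by linarith [ha.1]⟩ (by linarith)
    linarith) ((hL.comp_measurePreserving mp_refl).neg)
  rw [hmap] at h2
  have h3 : ∫ p, ker s p * Q2 p ∂nuU = ∫ p, - (ker s (1 - p) * Q p) ∂nuU := by
    rw [← int_refl]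
    congr 1; funext p; simp [hQ2]
  rw [h3, integral_neg] at h2
  have i1 : Integrable (fun p => ker s p * Q p) nuU := (ker_memLp hs).integrable_mul hL
  have i2 : Integrable (fun p => ker s (1 - p) * Q p) nuU :=
    ((ker_memLp hs).comp_measurePreserving mp_refl).integrable_mul hL
  have h4 : (s + 1) / (2 * s) * ∫ p, hh s p * Q p ∂nuU =
      (1/2) * (∫ p, ker s p * Q p ∂nuU - ∫ p, ker s (1 - p) * Q p ∂nuU) := by
    rw [← integral_sub i1 i2, ← integral_const_mul, ← integral_const_mul]
    congr 1; funext p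
    simp only [hh, ker]; field_simp; ring
  rw [h4]; linarith

open Filter Topology in
lemma exists_quantile (μ : Measure ℝ) [IsProbabilityMeasure μ] :
    ∃ Q : ℝ → ℝ, Measurable Q ∧ MonotoneOn Q (Ioo 0 1) ∧ Measure.map Q nuU = μ := by
  classical
  set F := ProbabilityTheory.cdf μ with hF
  let S : ℝ → Set ℝ := fun p => {x | p ≤ F x}
  have hne : ∀ p ∈ Ioo (0 : ℝ) 1, (S p).Nonempty := by
    intro p hp
    obtain ⟨x, hx⟩ := ((ProbabilityTheory.tendsto_cdf_atTop μ).eventually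
      (eventually_gt_nhds hp.2)).exists
    exact ⟨x, hx.le⟩
  have hbdd : ∀ p ∈ Ioo (0 : ℝ) 1, BddBelow (S p) := by
    intro p hp
    obtain ⟨x, hx⟩ := ((ProbabilityTheory.tendsto_cdf_atBot μ).eventually
      (eventually_lt_nhds hp.1)).exists
    refine ⟨x, fun y hy => ?_⟩
    by_contra hlt
    have h1 : F y ≤ F x := F.mono (not_le.1 hlt).le
    have h2 : p ≤ F y := hy
    exact absurd (h2.trans h1) (not_le.2 hx)
  have hgal : ∀ p ∈ Ioo (0 : ℝ) 1, ∀ x, sInf (S p) ≤ x ↔ p ≤ F x := by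
    intro p hp x
    constructor
    · intro h
      have hy : ∀ y, x < y → p ≤ F y := by
        intro y hxy
        obtain ⟨z, hz, hzy⟩ := exists_lt_of_csInf_lt (hne p hp) (h.trans_lt hxy)
        exact le_trans hz (F.mono hzy.le)
      have hc : Tendsto F (𝓝[>] x) (𝓝 (F x)) :=
        (F.right_continuous x).tendsto.mono_left (nhdsWithin_mono _ Ioi_subset_Ici_self)
      exact ge_of_tendsto hc (by filter_upwards [self_mem_nhdsWithin] with y h using hy y h)
    · intro h
      exact csInf_le (hbdd p hp) h
  let Q : ℝ → ℝ := fun p => if p ∈ Ioo (0 : ℝ) 1 then sInf (S p) else 0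
  have hpre : ∀ x, Q ⁻¹' Iic x ∩ Ioo 0 1 = Iic (F x) ∩ Ioo 0 1 := by
    intro x; ext p
    simp only [mem_inter_iff, mem_preimage, mem_Iic, and_congr_left_iff]
    intro hp
    simp only [Q, if_pos hp]
    exact hgal p hp x
  have hQm : Measurable Q := by
    refine measurable_of_Iic fun x => ?_
    have : Q ⁻¹' Iic x = (Iic (F x) ∩ Ioo 0 1) ∪ ({p | (0:ℝ) ≤ x} ∩ (Ioo 0 1)ᶜ) := by
      rw [← hpre x]
      ext p
      by_cases hp : p ∈ Ioo (0 : ℝ) 1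
      · simp [hp]
      · have hq : Q p = 0 := if_neg hp
        simp [hp, hq]
    rw [this]
    exact (measurableSet_Iic.inter measurableSet_Ioo).union
      ((MeasurableSet.const _).inter measurableSet_Ioo.compl)
  refine ⟨Q, hQm, ?_, ?_⟩
  · intro a ha b hb hab
    simp only [Q, if_pos ha, if_pos hb]
    rw [hgal a ha]
    exact hab.trans ((hgal b hb _).1 le_rfl)
  · have : IsProbabilityMeasure (Measure.map Q nuU) :=
      Measure.isProbabilityMeasure_map hQm.aemeasurable
    refine Measure.ext_of_Iic _ _ fun x => ?_
    rw [Measure.map_apply hQm measurableSet_Iic, nuU,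
      Measure.restrict_apply (hQm measurableSet_Iic), hpre x, ← ProbabilityTheory.ofReal_cdf μ x]
    have h1 : F x ≤ 1 := ProbabilityTheory.cdf_le_one μ x
    apply le_antisymm
    · calc volume (Iic (F x) ∩ Ioo 0 1) ≤ volume (Ioc 0 (F x)) :=
            measure_mono (fun p hp => ⟨hp.2.1, hp.1⟩)
        _ = _ := by simp [hF]
    · calc ENNReal.ofReal (F x) = volume (Ioo 0 (F x)) := by simp
        _ ≤ volume (Iic (F x) ∩ Ioo 0 1) := measure_mono (fun p hp => ⟨hp.2.le, hp.1, hp.2.trans_le h1⟩)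

lemma mVar_map {Q : ℝ → ℝ} (hQ : Measurable Q)
    (hsym : Measure.map (fun x : ℝ => -x) (Measure.map Q nuU) = Measure.map Q nuU) :
    mVar (Measure.map Q nuU) = ∫ p, Q p ^ 2 ∂nuU := by
  have h0 : ∫ y, y ∂(Measure.map Q nuU) = 0 := by
    have : ∫ y, y ∂(Measure.map Q nuU) = - ∫ y, y ∂(Measure.map Q nuU) := by
      conv_lhs => rw [← hsym]
      rw [integral_map (by fun_prop) (by fun_prop), integral_neg]
    linarith
  rw [mVar, h0, integral_map hQ.aemeasurable (by fun_prop)]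
  simp

lemma hh_norm {s : ℝ} (hs : -(1/2) < s) : ∫ p, hh s p ^ 2 ∂nuU =
    2 / (2 * s + 1) * (1 - Real.Gamma (s + 1) ^ 2 / Real.Gamma (2 * s + 1)) := by
  have i1 : Integrable (fun p : ℝ => (p ^ s) ^ 2) nuU := (pow_memLp hs).integrable_sq
  have i2 : Integrable (fun p : ℝ => ((1 - p) ^ s) ^ 2) nuU := (pow_memLp' hs).integrable_sq
  have i3 : Integrable (fun p : ℝ => p ^ s * (1 - p) ^ s) nuU :=
    (pow_memLp hs).integrable_mul (pow_memLp' hs)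
  have e : ∀ p, hh s p ^ 2 = ((p ^ s) ^ 2 + ((1 - p) ^ s) ^ 2) - 2 * (p ^ s * (1 - p) ^ s) := by
    intro p; simp only [hh]; ring
  simp only [e]
  have i12 : Integrable (fun p : ℝ => (p ^ s) ^ 2 + ((1 - p) ^ s) ^ 2) nuU := i1.add i2
  rw [integral_sub i12 (i3.const_mul 2), integral_add i1 i2, integral_const_mul,
    int_refl (fun p => (p ^ s) ^ 2)]
  have v1 : ∫ p, ((p : ℝ) ^ s) ^ 2 ∂nuU = 1 / (2 * s + 1) := by
    have : ∫ p, ((p : ℝ) ^ s) ^ 2 ∂nuU = ∫ p, p ^ (2 * s) ∂nuU := by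
      refine integral_congr_ae ?_
      filter_upwards [ae_mem] with p hp
      rw [mul_comm 2 s, Real.rpow_mul hp.1.le]; norm_cast
    rw [this, nuU, ← integral_Ioc_eq_integral_Ioo, ← intervalIntegral.integral_of_le zero_le_one,
      integral_rpow (Or.inl (by linarith))]
    rw [Real.zero_rpow (by linarith)]; simp
  have v3 : ∫ p, (p : ℝ) ^ s * (1 - p) ^ s ∂nuU
      = Real.Gamma (s + 1) ^ 2 / ((2 * s + 1) * Real.Gamma (2 * s + 1)) := by
    have hb := ProbabilityTheory.beta_eq_betaIntegralReal (s + 1) (s + 1) (by linarith) (by linarith)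
    have hc : Complex.betaIntegral ((s + 1 : ℝ) : ℂ) ((s + 1 : ℝ) : ℂ) =
        ((∫ p, (p : ℝ) ^ s * (1 - p) ^ s ∂nuU : ℝ) : ℂ) := by
      rw [Complex.betaIntegral, intervalIntegral.integral_of_le zero_le_one,
        integral_Ioc_eq_integral_Ioo, ← integral_complex_ofReal]
      refine integral_congr_ae ?_
      filter_upwards [ae_mem] with p hp
      push_cast
      rw [Complex.ofReal_cpow hp.1.le, Complex.ofReal_cpow (by linarith [hp.2])]
      simp
    rw [hc, Complex.ofReal_re] at hb
    rw [← hb, ProbabilityTheory.beta, ← Real.Gamma_add_one (by linarith)]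
    ring_nf
  rw [v1, v3]
  have : 0 < Real.Gamma (2 * s + 1) := Real.Gamma_pos_of_pos (by linarith)
  have : 0 < 2 * s + 1 := by linarith
  field_simp
  ring

lemma const_eq {s : ℝ} (hs : -(1/2) < s) (hs0 : s ≠ 0) :
    (s + 1) / Real.sqrt (2 * s ^ 2 * (2 * s + 1))
            * Real.sqrt (1 - Real.Gamma (s + 1) ^ 2 / Real.Gamma (2 * s + 1))
      = (s + 1) / (2 * |s|) * Real.sqrt (∫ p, hh s p ^ 2 ∂nuU) := by
  have h1 : 0 < 2 * s + 1 := by linarith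
  have ha : 0 < |s| := abs_pos.2 hs0
  rw [hh_norm hs, Real.sqrt_mul (x := 2 / (2 * s + 1)) (by positivity), ← mul_assoc]
  congr 1
  rw [← sq_abs s, Real.sqrt_mul (by positivity), Real.sqrt_mul (by norm_num), Real.sqrt_sq ha.le,
    Real.sqrt_div (by norm_num)]
  have h2 : Real.sqrt 2 ^ 2 = 2 := Real.sq_sqrt (by norm_num)
  have h3 : 0 < Real.sqrt (2 * s + 1) := Real.sqrt_pos.2 h1
  have h4 : 0 < Real.sqrt 2 := by positivity
  field_simp
  rw [h2]

lemma part_two {s : ℝ} (hs : -(1/2) < s) (hs0 : s ≠ 0) (μ : Measure ℝ)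
    (hp : IsProbabilityMeasure μ) (hi : Integrable (fun x : ℝ => x ^ 2) μ)
    (hsym : Measure.map (fun x : ℝ => -x) μ = μ) :
    ∫ x : ℝ, tsallisFn s ((μ (Iic x)).toReal) ≤
      (s + 1) / (2 * |s|) * Real.sqrt (∫ p, hh s p ^ 2 ∂nuU) * Real.sqrt (mVar μ) := by
  obtain ⟨Q, hQ, hmono, rfl⟩ := exists_quantile μ
  have hL : MemLp Q 2 nuU := by
    rw [memLp_two_iff_integrable_sq (by fun_prop)]
    exact hi.comp_measurable hQ
  rw [core_sym hs hs0 hQ hmono hL hsym, mVar_map hQ hsym]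
  have := cs_ineq (hh_memLp hs) hL
  have hs1 : 0 < s + 1 := by linarith
  calc _ ≤ |(s + 1) / (2 * s) * ∫ p, hh s p * Q p ∂nuU| := le_abs_self _
    _ = (s + 1) / (2 * |s|) * |∫ p, hh s p * Q p ∂nuU| := by
      rw [abs_mul, abs_div, abs_mul, abs_of_pos hs1]; simp
    _ ≤ _ := by
      rw [mul_assoc]; gcongr

lemma tsallis_nonneg {s t : ℝ} (hs : -(1/2) < s) (hs0 : s ≠ 0) (h0 : 0 ≤ t) (h1 : t ≤ 1) :
    0 ≤ tsallisFn s t := by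
  rw [tsallisFn, if_neg hs0]
  rcases h0.eq_or_lt with rfl | h0
  · simp
  rcases lt_or_gt_of_ne hs0 with h | h
  · have : 1 ≤ t ^ s := Real.one_le_rpow_of_pos_of_le_one_of_nonpos h0 h1 h.le
    rw [← mul_assoc]
    refine mul_nonneg_of_nonpos_of_nonpos ?_ (by linarith)
    exact mul_nonpos_of_nonpos_of_nonneg (by simpa using h.le) h0.le
  · have : t ^ s ≤ 1 := Real.rpow_le_one h0.le h1 h.le
    have : 0 ≤ 1 - t ^ s := by linarith
    positivity

/-- The increasing version of `hh`. -/
noncomputable def gg (s p : ℝ) : ℝ := SignType.sign s * hh s p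

lemma gg_meas (s : ℝ) : Measurable (gg s) := (hh_meas s).const_mul _

lemma gg_strict {s : ℝ} (hs0 : s ≠ 0) : StrictMonoOn (gg s) (Ioo 0 1) := by
  intro a ha b hb hab
  simp only [gg, hh]
  have h1 : 0 < 1 - b := by linarith [hb.2]
  rcases lt_or_gt_of_ne hs0 with h | h
  · rw [sign_neg h]
    have := Real.rpow_lt_rpow_of_neg ha.1 hab h
    have := Real.rpow_lt_rpow_of_neg h1 (by linarith : 1 - b < 1 - a) h
    simp; linarith
  · rw [sign_pos h]
    have := Real.rpow_lt_rpow ha.1.le hab h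
    have := Real.rpow_lt_rpow h1.le (by linarith : 1 - b < 1 - a) h
    simp; linarith

lemma gg_odd (s p : ℝ) : gg s (1 - p) = - gg s p := by
  simp [gg, hh]; ring

lemma gg_half (s : ℝ) : gg s (1/2) = 0 := by
  have := gg_odd s (1/2); norm_num at this ⊢; linarith

lemma gg_sq {s : ℝ} (hs0 : s ≠ 0) (p : ℝ) : gg s p ^ 2 = hh s p ^ 2 := by
  rcases lt_or_gt_of_ne hs0 with h | h <;> simp [gg, h]

/-- Truncated extremal quantile functions. -/
noncomputable def qq (s c p : ℝ) : ℝ := {p : ℝ | c ≤ |p - 1/2|}.indicator (gg s) p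

lemma set_meas (c : ℝ) : MeasurableSet {p : ℝ | c ≤ |p - 1/2|} :=
  measurableSet_le measurable_const (by fun_prop)

lemma qq_meas (s c : ℝ) : Measurable (qq s c) := (gg_meas s).indicator (set_meas c)

lemma qq_odd (s c p : ℝ) : qq s c (1 - p) = - qq s c p := by
  have : |1 - p - 1/2| = |p - 1/2| := by rw [← abs_neg]; ring_nf
  simp only [qq, indicator, mem_ofPred_eq, this, gg_odd]
  split_ifs <;> simp

lemma qq_mono {s c : ℝ} (hs0 : s ≠ 0) : MonotoneOn (qq s c) (Ioo 0 1) := by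
  intro a ha b hb hab
  have hm : ∀ a ∈ Ioo (0 : ℝ) 1, ∀ b ∈ Ioo (0 : ℝ) 1, a ≤ b → gg s a ≤ gg s b :=
    fun a ha b hb h => (gg_strict hs0).monotoneOn ha hb h
  have hhalf : (1/2 : ℝ) ∈ Ioo (0 : ℝ) 1 := by norm_num
  have h1 := hm a ha b hb hab
  simp only [qq, indicator, mem_ofPred_eq]
  split_ifs with h2 h3 h3
  · exact h1
  · rw [← gg_half s]
    refine hm _ ha _ hhalf ?_
    by_contra hlt
    push Not at hlt h3
    rw [abs_of_pos (by linarith)] at h2 h3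
    linarith
  · rw [← gg_half s]
    refine hm _ hhalf _ hb ?_
    by_contra hlt
    push Not at hlt h2
    rw [abs_of_neg (by linarith)] at h2 h3
    linarith
  · exact le_rfl

lemma qq_memLp {s : ℝ} (hs : -(1/2) < s) (c : ℝ) : MemLp (qq s c) 2 nuU :=
  ((hh_memLp hs).const_mul _).indicator (set_meas c)

lemma qq_sym (s c : ℝ) : Measure.map (fun x : ℝ => -x) (Measure.map (qq s c) nuU)
    = Measure.map (qq s c) nuU := by
  conv_rhs => rw [← mp_refl.map_eq]
  rw [Measure.map_map (by fun_prop) (qq_meas s c), Measure.map_map (qq_meas s c) (by fun_prop)]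
  congr 1; funext p; simp [qq_odd]

lemma qq_delta {s : ℝ} (hs : -(1/2) < s) (hs0 : s ≠ 0) (c : ℝ) :
    ∫ x : ℝ, tsallisFn s ((Measure.map (qq s c) nuU (Iic x)).toReal) =
      (s + 1) / (2 * |s|) * ∫ p, qq s c p ^ 2 ∂nuU := by
  rw [core_sym hs hs0 (qq_meas s c) (qq_mono hs0) (qq_memLp hs c) (qq_sym s c),
    ← integral_const_mul, ← integral_const_mul]
  congr 1; funext p
  simp only [qq, indicator]
  split_ifs
  · rcases lt_or_gt_of_ne hs0 with h | h
    · simp [gg, h, abs_of_neg h]; field_simp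
    · simp [gg, h, abs_of_pos h]; left; ring
  · simp

lemma hh_pos {s : ℝ} (hs : -(1/2) < s) (hs0 : s ≠ 0) : 0 < ∫ p, hh s p ^ 2 ∂nuU := by
  rw [integral_pos_iff_support_of_nonneg (fun p => sq_nonneg _) (hh_memLp hs).integrable_sq]
  have hsub : Ioo (1/2 : ℝ) 1 ⊆ Function.support (fun p => hh s p ^ 2) := by
    intro p hp
    have := gg_strict hs0 (a := 1/2) (b := p) (by norm_num) ⟨by linarith [hp.1], hp.2⟩ hp.1
    rw [gg_half] at this
    simp only [Function.mem_support]
    rw [← gg_sq hs0]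
    positivity
  refine lt_of_lt_of_le ?_ (measure_mono hsub)
  rw [nuU, Measure.restrict_apply measurableSet_Ioo, Ioo_inter_Ioo]
  norm_num

lemma qq_ivt {s : ℝ} (hs : -(1/2) < s) (hs0 : s ≠ 0) {a : ℝ} (h0 : 0 ≤ a)
    (h1 : a ≤ ∫ p, hh s p ^ 2 ∂nuU) : ∃ c, ∫ p, qq s c p ^ 2 ∂nuU = a := by
  have hi : Integrable (fun p => hh s p ^ 2) nuU := (hh_memLp hs).integrable_sq
  have hE : ∀ c : ℝ, 0 ≤ c → ∫ p, qq s c p ^ 2 ∂nuU =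
      ∫ p, hh s p ^ 2 ∂nuU - ∫ p in (1/2 - c)..(1/2 + c), hh s p ^ 2 ∂nuU := by
    intro c hc
    have hcompl : {p : ℝ | c ≤ |p - 1/2|} = (Ioo (1/2 - c) (1/2 + c))ᶜ := by
      ext p
      simp only [mem_ofPred_eq, mem_compl_iff, mem_Ioo, ← not_lt, abs_lt]
      refine not_congr ⟨fun h => ⟨by linarith [h.1], by linarith [h.2]⟩,
        fun h => ⟨by linarith [h.1], by linarith [h.2]⟩⟩
    have h2 : ∀ p, qq s c p ^ 2 = {p : ℝ | c ≤ |p - 1/2|}.indicator (fun p => hh s p ^ 2) p := by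
      intro p
      simp only [qq, indicator]
      split_ifs
      · exact gg_sq hs0 p
      · simp
    have : NullSingletonClass nuU := by unfold nuU; infer_instance
    simp only [h2]
    rw [integral_indicator (set_meas c), hcompl, intervalIntegral.integral_of_le (by linarith),
      integral_Ioc_eq_integral_Ioo, ← integral_add_compl (measurableSet_Ioo (a := 1/2 - c) (b := 1/2 + c)) hi]
    ring
  have : NullSingletonClass nuU := by unfold nuU; infer_instance
  have hii : ∀ a b, IntervalIntegrable (fun p => hh s p ^ 2) nuU a b := fun a b =>
    hi.intervalIntegrable
  have hcont : Continuous fun c : ℝ =>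
      ∫ p, hh s p ^ 2 ∂nuU - ∫ p in (1/2 - c)..(1/2 + c), hh s p ^ 2 ∂nuU := by
    have hp := intervalIntegral.continuous_primitive hii 0
    have : ∀ c : ℝ, ∫ p in (1/2 - c)..(1/2 + c), hh s p ^ 2 ∂nuU =
      (∫ p in (0)..(1/2 + c), hh s p ^ 2 ∂nuU) - ∫ p in (0)..(1/2 - c), hh s p ^ 2 ∂nuU := by
      intro c
      rw [intervalIntegral.integral_interval_sub_left (hii _ _) (hii _ _)]
    simp only [this]
    refine continuous_const.sub ((hp.comp (by fun_prop : Continuous fun c : ℝ => 1/2 + c)).sub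
      (hp.comp (by fun_prop : Continuous fun c : ℝ => 1/2 - c)))
  have hivt := intermediate_value_Icc' (by norm_num : (0 : ℝ) ≤ 1/2) hcont.continuousOn
  obtain ⟨c, hc, hca⟩ := hivt (show a ∈ _ from by
    refine ⟨le_trans (le_of_eq ?_) h0, by simpa using h1⟩
    norm_num
    rw [intervalIntegral.integral_of_le zero_le_one, integral_Ioc_eq_integral_Ioo, sub_eq_zero]
    conv_rhs => rw [nuU, Measure.restrict_restrict measurableSet_Ioo, inter_self]
    rfl)
  exact ⟨c, (hE c hc.1).trans hca⟩

/-- **Theorem sRan, case `s ≠ 0`.** For every `s ∈ (−1/2,0) ∪ (0,∞)`, the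
closure of the set of ratios `Δ_s(X)/σ_X` over square-integrable symmetric random variables
(identified with their laws `μ` on `ℝ`) with `σ_X > 0` equals `[0, M_s]` where
`M_s = ((s+1)/√(2s²(2s+1))) √(1 − Γ(s+1)²/Γ(2s+1))`; in particular `Δ_s(X) ≤ M_s σ_X` for
every symmetric square-integrable `X`, with equality for `X = (1−U)^s − U^s`, `U` uniform
on `(0,1)`. -/
theorem tsallis_range_symmetric (s : ℝ)
    (hs : s ∈ Ioo (-(1 / 2 : ℝ)) 0 ∪ Ioi (0 : ℝ)) :
    closure {r : ℝ | ∃ μ : Measure ℝ, IsProbabilityMeasure μ ∧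
        Integrable (fun x : ℝ => x ^ 2) μ ∧ Measure.map (fun x : ℝ => -x) μ = μ ∧
        0 < Real.sqrt (mVar μ) ∧
        r = (∫ x : ℝ, tsallisFn s ((μ (Iic x)).toReal)) / Real.sqrt (mVar μ)}
      = Icc (0 : ℝ)
          (((s + 1) / Real.sqrt (2 * s ^ 2 * (2 * s + 1)))
            * Real.sqrt (1 - Real.Gamma (s + 1) ^ 2 / Real.Gamma (2 * s + 1)))
    ∧ (∀ μ : Measure ℝ, IsProbabilityMeasure μ → Integrable (fun x : ℝ => x ^ 2) μ →
        Measure.map (fun x : ℝ => -x) μ = μ →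
        (∫ x : ℝ, tsallisFn s ((μ (Iic x)).toReal))
          ≤ (((s + 1) / Real.sqrt (2 * s ^ 2 * (2 * s + 1)))
              * Real.sqrt (1 - Real.Gamma (s + 1) ^ 2 / Real.Gamma (2 * s + 1)))
            * Real.sqrt (mVar μ))
    ∧ (∫ x : ℝ, tsallisFn s
          ((Measure.map (fun u : ℝ => (1 - u) ^ s - u ^ s)
              ((volume : Measure ℝ).restrict (Ioo (0 : ℝ) 1)) (Iic x)).toReal))
        = (((s + 1) / Real.sqrt (2 * s ^ 2 * (2 * s + 1)))
            * Real.sqrt (1 - Real.Gamma (s + 1) ^ 2 / Real.Gamma (2 * s + 1)))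
          * Real.sqrt (mVar (Measure.map (fun u : ℝ => (1 - u) ^ s - u ^ s)
              ((volume : Measure ℝ).restrict (Ioo (0 : ℝ) 1)))) := by
  have hs1 : -(1/2) < s := by
    rcases hs with h | h
    · exact h.1
    · have : (0:ℝ) < s := h
      linarith
  have hs0 : s ≠ 0 := by
    rcases hs with h | h
    · exact h.2.ne
    · exact (show (0:ℝ) < s from h).ne'
  rw [const_eq hs1 hs0]
  have hK : 0 < (s + 1) / (2 * |s|) := by
    have := abs_pos.2 hs0
    have : 0 < s + 1 := by linarith
    positivity
  have hA := hh_pos hs1 hs0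
  have hM : 0 < (s + 1) / (2 * |s|) * Real.sqrt (∫ p, hh s p ^ 2 ∂nuU) :=
    mul_pos hK (Real.sqrt_pos.2 hA)
  refine ⟨?_, part_two hs1 hs0, ?_⟩
  · apply subset_antisymm
    · refine closure_minimal ?_ isClosed_Icc
      rintro r ⟨μ, hp, hi, hsym, hpos, rfl⟩
      constructor
      · refine div_nonneg (integral_nonneg fun x => ?_) hpos.le
        exact tsallis_nonneg hs1 hs0 ENNReal.toReal_nonneg
          (ENNReal.toReal_le_of_le_ofReal zero_le_one (by simpa using prob_le_one))
      · rw [div_le_iff₀ hpos]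
        exact part_two hs1 hs0 μ hp hi hsym
    · rw [← closure_Ioc hM.ne]
      refine closure_mono ?_
      rintro r ⟨hr0, hr1⟩
      set K := (s + 1) / (2 * |s|) with hKdef
      have hrK : 0 < r / K := div_pos hr0 hK
      obtain ⟨c, hc⟩ := qq_ivt hs1 hs0 (a := (r / K) ^ 2) (by positivity) (by
        have : r / K ≤ Real.sqrt (∫ p, hh s p ^ 2 ∂nuU) := by
          rw [div_le_iff₀ hK, mul_comm]; exact hr1
        calc (r / K) ^ 2 ≤ Real.sqrt (∫ p, hh s p ^ 2 ∂nuU) ^ 2 := by gcongr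
          _ = _ := Real.sq_sqrt hA.le)
      have hv : Real.sqrt (mVar (Measure.map (qq s c) nuU)) = r / K := by
        rw [mVar_map (qq_meas s c) (qq_sym s c), hc, Real.sqrt_sq hrK.le]
      refine ⟨Measure.map (qq s c) nuU,
        Measure.isProbabilityMeasure_map (qq_meas s c).aemeasurable, ?_, qq_sym s c, ?_, ?_⟩
      · rw [integrable_map_measure (by fun_prop) (qq_meas s c).aemeasurable]
        exact (qq_memLp hs1 c).integrable_sq
      · rw [hv]; exact hrK
      · rw [hv, qq_delta hs1 hs0, hc, ← hKdef]
        field_simp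
  · have hmap : Measure.map (fun u : ℝ => (1 - u) ^ s - u ^ s)
        ((volume : Measure ℝ).restrict (Ioo (0 : ℝ) 1)) = Measure.map (qq s 0) nuU := by
      have hq : qq s 0 = gg s := by
        funext p; simp [qq, abs_nonneg]
      rcases lt_or_gt_of_ne hs0 with h | h
      · rw [hq, nuU]
        congr 1; funext p; simp [gg, hh, h]
      · rw [← qq_sym, Measure.map_map (by fun_prop) (qq_meas s 0), hq, nuU]
        congr 1; funext p; simp [gg, hh, h]
    rw [hmap, qq_delta hs1 hs0, mVar_map (qq_meas s 0) (qq_sym s 0)]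
    have : ∫ p, qq s 0 p ^ 2 ∂nuU = ∫ p, hh s p ^ 2 ∂nuU := by
      congr 1; funext p
      rw [← gg_sq hs0]; simp [qq, abs_nonneg]
    rw [this, mul_assoc, Real.mul_self_sqrt hA.le]
end

section
/- The closure in ℝ of the set { Δ_0(X)/σ_X : X a square-integrable real random variable with σ_X > 0 such that X and −X have the same distribution } equals the interval [0, π/(2√3)], where Δ_0(X) = −∫_ℝ F_X(x) log F_X(x) dx. In particular, for every symmetric square-integrable X, Δ_0(X) ≤ (π/(2√3)) σ_X. -/
open MeasureTheory Set Real

/-! ### Calculus integrals -/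

lemma alt_sum : HasSum (fun n : ℕ => (-1 : ℝ) ^ n / ((n : ℝ) + 1) ^ 2) (π ^ 2 / 12) := by
  have h0 := hasSum_zeta_two
  have h2 : HasSum (fun n : ℕ => if Even n then (1 : ℝ) / (n : ℝ) ^ 2 else 0) (π ^ 2 / 24) := by
    have hinj : Function.Injective (fun n : ℕ => 2 * n) := fun a b h => by simpa using h
    rw [← hinj.hasSum_iff]
    · have := h0.mul_left (1 / 4)
      convert! this using 1
      · ext n
        simp [Function.comp]
        ring
      · ring
    · intro x hx
      rw [if_neg]
      rintro ⟨k, hk⟩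
      exact hx ⟨k, by simp; omega⟩
  have h3 := h0.sub (h2.mul_left 2)
  have h4 : HasSum (fun n : ℕ => (1 : ℝ) / ((n + 1 : ℕ) : ℝ) ^ 2 -
      2 * (if Even (n + 1) then (1 : ℝ) / ((n + 1 : ℕ) : ℝ) ^ 2 else 0)) (π ^ 2 / 12) := by
    rw [hasSum_nat_add_iff (f := fun n : ℕ => (1 : ℝ) / (n : ℝ) ^ 2 -
      2 * (if Even n then (1 : ℝ) / (n : ℝ) ^ 2 else 0)) 1]
    convert! h3 using 1
    simp
    ring
  convert! h4 using 1
  ext n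
  rcases Nat.even_or_odd n with h | h
  · rw [if_neg (by simpa [Nat.even_add_one] using h), h.neg_one_pow]
    push_cast; ring
  · rw [if_pos (by simpa [Nat.even_add_one] using h), h.neg_one_pow]
    push_cast; ring

lemma log_hasSum {x : ℝ} (hx : 0 < x) :
    HasSum (fun n : ℕ => (-1 : ℝ) ^ n / ((n : ℝ) + 1) * exp (-((n : ℝ) + 1) * x))
      (log (1 + exp (-x))) := by
  have h1 : |-exp (-x)| < 1 := by
    rw [abs_neg, abs_of_pos (exp_pos _)]; simpa using hx
  have := (hasSum_pow_div_log_of_abs_lt_one h1).neg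
  convert! this using 1
  · ext n
    have : exp (-((n : ℝ) + 1) * x) = exp (-x) ^ (n + 1) := by
      rw [← exp_nat_mul]; push_cast; ring_nf
    rw [this, neg_pow (exp (-x)), pow_succ (-1 : ℝ)]
    ring
  · simp

lemma L_int : ∫ x in Ioi (0 : ℝ), log (1 + exp (-x)) = π ^ 2 / 12 := by
  have hi : ∀ n : ℕ, ∫ x in Ioi (0 : ℝ), exp (-((n : ℝ) + 1) * x) = 1 / ((n : ℝ) + 1) := by
    intro n
    rw [integral_exp_mul_Ioi (by linarith [(Nat.cast_nonneg n : (0 : ℝ) ≤ n)])]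
    simp
    rw [← neg_add_rev, neg_div_neg_eq, add_comm]; simp
  have hs : Summable (fun n : ℕ => 1 / ((n : ℝ) + 1) ^ 2) := by
    have := (summable_nat_add_iff 1).2 hasSum_zeta_two.summable
    simpa using this
  have := hasSum_integral_of_summable_integral_norm (μ := volume.restrict (Ioi (0 : ℝ)))
    (F := fun (n : ℕ) (x : ℝ) => (-1 : ℝ) ^ n / ((n : ℝ) + 1) * exp (-((n : ℝ) + 1) * x))
    (fun n => ((integrableOn_exp_mul_Ioi
      (by linarith [(Nat.cast_nonneg n : (0 : ℝ) ≤ n)]) 0).const_mul _)) (by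
      convert! hs using 1
      ext n
      have : ∀ x : ℝ, ‖(-1 : ℝ) ^ n / ((n : ℝ) + 1) * exp (-((n : ℝ) + 1) * x)‖ =
          1 / ((n : ℝ) + 1) * exp (-((n : ℝ) + 1) * x) := by
        intro x
        rw [norm_mul, norm_div, norm_pow, norm_neg, norm_one, one_pow, Real.norm_of_nonneg (exp_pos _).le,
          Real.norm_of_nonneg (by positivity)]
      simp_rw [this]
      rw [integral_const_mul, hi]
      field_simp)
  have h2 : HasSum (fun n : ℕ => ∫ x in Ioi (0 : ℝ),
      (-1 : ℝ) ^ n / ((n : ℝ) + 1) * exp (-((n : ℝ) + 1) * x)) (π ^ 2 / 12) := by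
    convert! alt_sum using 1
    ext n
    rw [integral_const_mul, hi]
    field_simp
  rw [← this.unique h2]
  refine setIntegral_congr_fun measurableSet_Ioi fun x hx => ?_
  exact (log_hasSum hx).tsum_eq.symm

lemma L_integrable : IntegrableOn (fun x : ℝ => log (1 + exp (-x))) (Ioi 0) := by
  by_contra h
  have := L_int
  rw [integral_undef h] at this
  have h2 : 0 < π ^ 2 / 12 := by positivity
  linarith


lemma tsig_hasDeriv (x : ℝ) : HasDerivAt (fun x : ℝ => x * log (1 + exp (-x)))
    (log (1 + exp (-x)) - x * sigmoid (-x)) x := by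
  have h1 : HasDerivAt (fun x : ℝ => 1 + exp (-x)) (-exp (-x)) x := by
    simpa using ((hasDerivAt_neg x).exp.const_add 1)
  have h2 := (hasDerivAt_id x).mul (h1.log (by positivity))
  convert! h2 using 1
  rw [← sigmoid_mul_rexp_neg, sigmoid_def]
  simp
  field_simp
  ring

lemma tsig_nonneg {x : ℝ} (hx : 0 < x) : 0 ≤ x * sigmoid (-x) :=
  mul_nonneg hx.le (sigmoid_nonneg _)

lemma sigmoid_neg_le (x : ℝ) : sigmoid (-x) ≤ exp (-x) := by
  rw [← sigmoid_mul_rexp_neg]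
  exact mul_le_of_le_one_left (exp_pos _).le (sigmoid_le_one x)

lemma sig_integrable : IntegrableOn (fun x : ℝ => sigmoid (-x)) (Ioi 0) := by
  refine (integrableOn_exp_neg_Ioi 0).mono' (by fun_prop) ?_
  filter_upwards with x
  rw [Real.norm_of_nonneg (sigmoid_nonneg _)]
  exact sigmoid_neg_le x

lemma tsig_integrable : IntegrableOn (fun x : ℝ => x * sigmoid (-x)) (Ioi 0) := by
  have h := integrableOn_exp_mul_Ioi (a := -(1/2)) (by norm_num) 0
  refine (h.const_mul 2).mono' (by fun_prop) ?_
  filter_upwards [ae_restrict_mem measurableSet_Ioi] with x hx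
  rw [Real.norm_of_nonneg (tsig_nonneg hx)]
  have h1 : x ≤ 2 * exp (x / 2) := by linarith [add_one_le_exp (x / 2)]
  have h2 : exp (-(1/2) * x) = exp (x / 2) * exp (-x) := by rw [← exp_add]; ring_nf
  rw [h2, ← mul_assoc]
  exact mul_le_mul h1 (sigmoid_neg_le x) (sigmoid_nonneg _) (by positivity)

lemma L_le (x : ℝ) : log (1 + exp (-x)) ≤ exp (-x) := by
  have := log_le_sub_one_of_pos (show 0 < 1 + exp (-x) by positivity)
  linarith

lemma L_nonneg (x : ℝ) : 0 ≤ log (1 + exp (-x)) :=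
  log_nonneg (by linarith [exp_pos (-x)])

lemma tsig_int : ∫ x in Ioi (0 : ℝ), x * sigmoid (-x) = π ^ 2 / 12 := by
  have h := integral_Ioi_of_hasDerivAt_of_tendsto' (a := 0) (m := 0) (fun x _ => tsig_hasDeriv x)
    (L_integrable.sub tsig_integrable) (by
      have h1 := tendsto_pow_mul_exp_neg_atTop_nhds_zero 1
      refine squeeze_zero' ?_ ?_ h1
      · filter_upwards [Filter.eventually_ge_atTop 0] with x hx
        exact mul_nonneg hx (L_nonneg x)
      · filter_upwards [Filter.eventually_ge_atTop 0] with x hx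
        simpa using mul_le_mul_of_nonneg_left (L_le x) hx)
  rw [integral_sub L_integrable tsig_integrable, L_int] at h
  simp at h
  linarith

/-- Tangent-line inequality for the binary entropy. -/
lemma binEntropy_le {q : ℝ} (h0 : 0 ≤ q) (h1 : q ≤ 1) (x : ℝ) :
    binEntropy q ≤ x * q + log (1 + exp (-x)) := by
  rcases h0.eq_or_lt with rfl | h0
  · simpa using L_nonneg x
  rcases h1.eq_or_lt with rfl | h1
  · simp
    have h := log_le_log (exp_pos (-x)) (show exp (-x) ≤ 1 + exp (-x) by linarith)
    rw [log_exp] at h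
    linarith
  have h2 : 0 < 1 - q := by linarith
  have hc := strictConcaveOn_log_Ioi.concaveOn.2 (show exp (-x) / q ∈ Ioi 0 from by
    simp only [mem_Ioi]; positivity) (show 1 / (1 - q) ∈ Ioi 0 from by
    simp only [mem_Ioi]; positivity) h0.le h2.le (by ring)
  simp only [smul_eq_mul] at hc
  rw [mul_div_cancel₀ _ h0.ne', mul_div_cancel₀ _ h2.ne', log_div (exp_pos _).ne' h0.ne',
    log_exp, one_div, log_inv, add_comm (exp (-x))] at hc
  rw [binEntropy, log_inv, log_inv]
  linarith

lemma binEntropy_sig (x : ℝ) :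
    binEntropy (sigmoid (-x)) = x * sigmoid (-x) + log (1 + exp (-x)) := by
  have h1 : log (sigmoid x) = - log (1 + exp (-x)) := by rw [sigmoid_def, log_inv]
  have h2 : log (sigmoid (-x)) = - log (1 + exp (-x)) - x := by
    rw [← sigmoid_mul_rexp_neg, log_mul (sigmoid_pos x).ne' (exp_pos _).ne', h1, log_exp]; ring
  have h3 : 1 - sigmoid (-x) = sigmoid x := by rw [sigmoid_neg]; ring
  rw [binEntropy, h3, log_inv, log_inv, h1, h2]
  have : sigmoid x = 1 - sigmoid (-x) := h3.symm
  rw [this]; ring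

/-- Small-mass bound. -/
lemma binEntropy_small {t g : ℝ} (ht : 0 < t) (ht1 : t ≤ 1) (g0 : 0 < g) (g1 : g < 1) :
    binEntropy (t ^ 4 * g) ≤ t ^ 3 * (5 * g + binEntropy g) := by
  have hp : 0 < t ^ 4 := by positivity
  have hp1 : t ^ 4 ≤ 1 := pow_le_one₀ ht.le ht1
  have hq1 : t ^ 4 * g < 1 := by nlinarith
  have ht3 : t ^ 4 ≤ t ^ 3 := pow_le_pow_of_le_one ht.le ht1 (by norm_num)
  have e1 : binEntropy (t ^ 4 * g) = g * (t ^ 4 * (4 * -log t)) + t ^ 4 * (g * -log g)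
      + (1 - t ^ 4 * g) * -log (1 - t ^ 4 * g) := by
    rw [binEntropy, log_inv, log_inv, log_mul hp.ne' g0.ne', log_pow]
    push_cast; ring
  have a1 : t ^ 4 * (4 * -log t) ≤ 4 * t ^ 3 := by
    have := one_sub_inv_le_log_of_pos ht
    have h : t * -log t ≤ 1 := by
      have h2 := mul_le_mul_of_nonneg_left this ht.le
      rw [mul_sub, mul_inv_cancel₀ ht.ne'] at h2
      linarith
    have := mul_le_mul_of_nonneg_left h (show 0 ≤ 4 * t ^ 3 by positivity)
    nlinarith
  have a2 : ∀ u : ℝ, 0 < u → u * -log u ≤ 1 - u := by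
    intro u hu
    have h2 := mul_le_mul_of_nonneg_left (one_sub_inv_le_log_of_pos hu) hu.le
    rw [mul_sub, mul_inv_cancel₀ hu.ne'] at h2
    linarith
  have a3 := a2 (1 - t ^ 4 * g) (by linarith)
  have a4 : g * -log g ≤ binEntropy g := by
    rw [binEntropy, log_inv, log_inv]
    have : 0 ≤ (1 - g) * -log (1 - g) :=
      mul_nonneg (by linarith) (by linarith [log_nonpos (show 0 ≤ 1 - g by linarith) (by linarith)])
    linarith
  have a5 : 0 ≤ g * -log g := mul_nonneg g0.le (by linarith [log_nonpos g0.le g1.le])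
  rw [e1]
  have b1 := mul_le_mul_of_nonneg_left a1 g0.le
  have b2 : t ^ 4 * (g * -log g) ≤ t ^ 3 * binEntropy g :=
    mul_le_mul ht3 a4 a5 (by positivity)
  have b3 : t ^ 4 * g ≤ t ^ 3 * g := mul_le_mul_of_nonneg_right ht3 g0.le
  nlinarith

/-! ### Symmetric measures -/

/-- Right tail of a measure. -/
noncomputable def tl (μ : Measure ℝ) (t : ℝ) : ℝ := (μ (Ioi t)).toReal

lemma tl_nonneg (μ : Measure ℝ) (t : ℝ) : 0 ≤ tl μ t := ENNReal.toReal_nonneg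

lemma tl_le_one (μ : Measure ℝ) [IsProbabilityMeasure μ] (t : ℝ) : tl μ t ≤ 1 := by
  have := ENNReal.toReal_mono ENNReal.one_ne_top (prob_le_one (μ := μ) (s := Ioi t))
  simpa [tl] using this

lemma tl_anti (μ : Measure ℝ) [IsProbabilityMeasure μ] : Antitone (tl μ) := fun _ _ h =>
  ENNReal.toReal_mono (measure_ne_top _ _) (measure_mono (Ioi_subset_Ioi h))

lemma tl_meas (μ : Measure ℝ) [IsProbabilityMeasure μ] : Measurable (tl μ) :=
  (tl_anti μ).measurable

lemma F_eq (μ : Measure ℝ) [IsProbabilityMeasure μ] (t : ℝ) :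
    (μ (Iic t)).toReal = 1 - tl μ t := by
  have := prob_compl_eq_one_sub (μ := μ) (measurableSet_Ioi (a := t))
  rw [compl_Ioi] at this
  rw [this, ENNReal.toReal_sub_of_le prob_le_one ENNReal.one_ne_top]
  simp [tl]

lemma sym_Iic {μ : Measure ℝ} (hs : Measure.map (fun x : ℝ => -x) μ = μ) (t : ℝ) :
    μ (Iic (-t)) = μ (Ici t) := by
  conv_lhs => rw [← hs]
  rw [Measure.map_apply measurable_neg measurableSet_Iic]
  congr 1; ext x; simp

lemma sym_Iio {μ : Measure ℝ} (hs : Measure.map (fun x : ℝ => -x) μ = μ) (t : ℝ) :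
    μ (Iio (-t)) = μ (Ioi t) := by
  conv_lhs => rw [← hs]
  rw [Measure.map_apply measurable_neg measurableSet_Iio]
  congr 1; ext x; simp

lemma mVar_eq {μ : Measure ℝ} (hs : Measure.map (fun x : ℝ => -x) μ = μ) :
    mVar μ = ∫ x, x ^ 2 ∂μ := by
  have h0 : ∫ y, y ∂μ = 0 := by
    have h : ∫ y, y ∂μ = ∫ y, -y ∂μ := by
      conv_lhs => rw [← hs]
      exact integral_map measurable_neg.aemeasurable aestronglyMeasurable_id
    rw [integral_neg] at h
    linarith
  simp [mVar, h0]

lemma lint_sq {μ : Measure ℝ} [IsProbabilityMeasure μ]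
    (hs : Measure.map (fun x : ℝ => -x) μ = μ) :
    ∫⁻ x, ENNReal.ofReal (x ^ 2) ∂μ =
      ∫⁻ t in Ioi (0 : ℝ), ENNReal.ofReal (4 * (t * tl μ t)) := by
  have h := lintegral_rpow_eq_lintegral_meas_lt_mul (μ := μ) (f := fun x : ℝ => |x|)
    (Filter.Eventually.of_forall fun x => abs_nonneg x) (by fun_prop) (p := 2) (by norm_num)
  have e : ∀ x : ℝ, |x| ^ (2 : ℝ) = x ^ 2 := fun x => by
    rw [rpow_two, sq_abs]
  simp_rw [e] at h
  rw [h, ← lintegral_const_mul']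
  swap
  · exact ENNReal.ofReal_ne_top
  refine setLIntegral_congr_fun measurableSet_Ioi fun t ht => ?_
  have ht : (0 : ℝ) < t := ht
  have hset : {a : ℝ | t < |a|} = Iio (-t) ∪ Ioi t := by
    ext x; simp only [mem_ofPred_eq, lt_abs, mem_union, mem_Iio, mem_Ioi]
    constructor <;> rintro (h | h)
    · right; exact h
    · left; linarith
    · right; linarith
    · left; exact h
  have hd : Disjoint (Iio (-t)) (Ioi t) := by
    rw [Set.disjoint_left]; intro x hx hx'
    simp only [mem_Iio, mem_Ioi] at hx hx'; linarith
  have hm : μ (Ioi t) = ENNReal.ofReal (tl μ t) := by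
    rw [tl, ENNReal.ofReal_toReal (measure_ne_top _ _)]
  rw [hset, measure_union hd measurableSet_Ioi, sym_Iio hs, hm,
    ← ENNReal.ofReal_add (tl_nonneg _ _) (tl_nonneg _ _),
    ← ENNReal.ofReal_mul (by have := tl_nonneg μ t; linarith), ← ENNReal.ofReal_mul (by norm_num)]
  congr 1
  norm_num
  ring

lemma tail_sq {μ : Measure ℝ} [IsProbabilityMeasure μ]
    (hs : Measure.map (fun x : ℝ => -x) μ = μ) :
    (Integrable (fun x : ℝ => x ^ 2) μ ↔ IntegrableOn (fun t => t * tl μ t) (Ioi 0)) ∧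
    mVar μ = 4 * ∫ t in Ioi (0 : ℝ), t * tl μ t := by
  have hm : AEStronglyMeasurable (fun t => 4 * (t * tl μ t)) (volume.restrict (Ioi 0)) :=
    ((measurable_id.mul (tl_meas μ)).const_mul 4).aestronglyMeasurable
  have hnn : 0 ≤ᵐ[volume.restrict (Ioi (0 : ℝ))] (fun t => 4 * (t * tl μ t)) := by
    filter_upwards [ae_restrict_mem measurableSet_Ioi] with x hx
    have hx : (0 : ℝ) < x := hx
    have := tl_nonneg μ x
    simp only [Pi.zero_apply]; positivity
  have hm2 : AEStronglyMeasurable (fun x : ℝ => x ^ 2) μ := by fun_prop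
  have hnn2 : 0 ≤ᵐ[μ] (fun x : ℝ => x ^ 2) := Filter.Eventually.of_forall fun x => sq_nonneg x
  constructor
  · rw [← lintegral_ofReal_ne_top_iff_integrable hm2 hnn2, lint_sq hs,
      lintegral_ofReal_ne_top_iff_integrable hm hnn]
    exact integrable_const_mul_iff (isUnit_iff_ne_zero.2 (by norm_num)) _
  · rw [mVar_eq hs, ← integral_const_mul, integral_eq_lintegral_of_nonneg_ae hnn2 hm2,
      integral_eq_lintegral_of_nonneg_ae hnn hm, lint_sq hs]

lemma binEntropy_tl_integrable {μ : Measure ℝ} [IsProbabilityMeasure μ]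
    (hi : IntegrableOn (fun t => t * tl μ t) (Ioi 0)) :
    IntegrableOn (fun t => binEntropy (tl μ t)) (Ioi 0) := by
  refine (hi.add L_integrable).mono' (binEntropy_continuous.measurable.comp
    (tl_meas μ)).aestronglyMeasurable ?_
  filter_upwards with x
  rw [Real.norm_of_nonneg (binEntropy_nonneg (tl_nonneg _ _) (tl_le_one _ _))]
  exact binEntropy_le (tl_nonneg _ _) (tl_le_one _ _) x

lemma entropy_eq {μ : Measure ℝ} [IsProbabilityMeasure μ]
    (hs : Measure.map (fun x : ℝ => -x) μ = μ)
    (hi : IntegrableOn (fun t => t * tl μ t) (Ioi 0)) :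
    (-∫ x : ℝ, (μ (Iic x)).toReal * Real.log ((μ (Iic x)).toReal)) =
      ∫ t in Ioi (0 : ℝ), binEntropy (tl μ t) := by
  have hb := binEntropy_tl_integrable hi
  have hae : ∀ᵐ x : ℝ, (μ (Iic (-x))).toReal = tl μ x := by
    filter_upwards [meas_le_ae_eq_meas_lt μ (volume : Measure ℝ) (fun x : ℝ => x)] with x hx
    rw [sym_Iic hs, tl]
    exact congrArg ENNReal.toReal hx
  set f : ℝ → ℝ := fun x => negMulLog (μ (Iic x)).toReal with hf
  have e0 : (-∫ x : ℝ, (μ (Iic x)).toReal * Real.log ((μ (Iic x)).toReal)) = ∫ x, f x := by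
    rw [← integral_neg]; simp [hf, negMulLog]
  have n1 : ∀ x, 0 ≤ negMulLog (tl μ x) := fun x => negMulLog_nonneg (tl_nonneg _ _) (tl_le_one _ _)
  have n2 : ∀ x, 0 ≤ negMulLog (1 - tl μ x) := fun x =>
    negMulLog_nonneg (by linarith [tl_le_one μ x]) (by linarith [tl_nonneg μ x])
  have i1 : IntegrableOn (fun x => negMulLog (tl μ x)) (Ioi 0) := by
    refine hb.mono' (continuous_negMulLog.measurable.comp (tl_meas μ)).aestronglyMeasurable ?_
    filter_upwards with x
    rw [Real.norm_of_nonneg (n1 x), binEntropy_eq_negMulLog_add_negMulLog_one_sub]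
    linarith [n2 x]
  have i2 : IntegrableOn (fun x => negMulLog (1 - tl μ x)) (Ioi 0) := by
    refine hb.mono' (continuous_negMulLog.measurable.comp
      ((tl_meas μ).const_sub 1)).aestronglyMeasurable ?_
    filter_upwards with x
    rw [Real.norm_of_nonneg (n2 x), binEntropy_eq_negMulLog_add_negMulLog_one_sub]
    linarith [n1 x]
  have f2 : f = fun x => negMulLog (1 - tl μ x) := by
    ext x; rw [hf]; simp only; rw [F_eq]
  have f1 : (fun x => f (-x)) =ᵐ[volume.restrict (Ioi 0)] fun x => negMulLog (tl μ x) := by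
    refine ae_restrict_of_ae ?_
    filter_upwards [hae] with x hx
    simp only [hf, hx]
  have i3 : IntegrableOn f (Ioi 0) := by rw [f2]; exact i2
  have i4 : IntegrableOn f (Iic 0) := by
    have h : IntegrableOn (fun x => f (-x)) (Ioi 0) := i1.congr f1.symm
    have h2 : IntegrableOn f (Iio 0) := by
      have A : MeasurableEmbedding fun x : ℝ => -x :=
        (Homeomorph.neg ℝ).isClosedEmbedding.measurableEmbedding
      have h3 := A.integrableOn_map_iff (μ := (volume : Measure ℝ)) (f := f) (s := Iio 0)
      rw [show Measure.map (fun x : ℝ => -x) volume = volume from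
        Measure.map_neg_eq_self (volume : Measure ℝ)] at h3
      rw [h3]
      convert! h using 1
      ext x; simp
    rw [integrableOn_Iic_iff_integrableOn_Iio]
    exact h2
  rw [e0, ← setIntegral_univ, ← Iic_union_Ioi (a := (0 : ℝ)),
    setIntegral_union (Iic_disjoint_Ioi le_rfl) measurableSet_Ioi i4 i3]
  have h := integral_comp_neg_Ioi 0 f
  rw [neg_zero] at h
  rw [← h, integral_congr_ae f1, f2, ← integral_add i1 i2]
  simp_rw [binEntropy_eq_negMulLog_add_negMulLog_one_sub]

lemma upper {μ : Measure ℝ} [IsProbabilityMeasure μ]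
    (hs : Measure.map (fun x : ℝ => -x) μ = μ) (hq : Integrable (fun x : ℝ => x ^ 2) μ) :
    (-∫ x : ℝ, (μ (Iic x)).toReal * Real.log ((μ (Iic x)).toReal))
          ≤ (π / (2 * Real.sqrt 3)) * Real.sqrt (mVar μ) := by
  obtain ⟨h1, h2⟩ := tail_sq hs
  have hi := h1.1 hq
  rw [entropy_eq hs hi]
  have hv : 0 ≤ mVar μ := by rw [mVar_eq hs]; exact integral_nonneg fun x => sq_nonneg x
  have h3 : 0 < √3 := by positivity
  have h33 : √3 * √3 = 3 := mul_self_sqrt (by norm_num)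
  have key : ∀ l : ℝ, 0 < l → ∫ t in Ioi (0 : ℝ), binEntropy (tl μ t) ≤
      l * (mVar μ / 4) + l⁻¹ * (π ^ 2 / 12) := by
    intro l hl
    have iL : IntegrableOn (fun x => log (1 + exp (-(l * x)))) (Ioi 0) := by
      have := integrableOn_Ioi_comp_mul_left_iff (fun x => log (1 + exp (-x))) 0 hl
      rw [mul_zero] at this
      exact this.2 L_integrable
    have eL := integral_comp_mul_left_Ioi (fun x => log (1 + exp (-x))) 0 hl
    rw [mul_zero, L_int, smul_eq_mul] at eL
    have e2 : mVar μ / 4 = ∫ t in Ioi (0 : ℝ), t * tl μ t := by rw [h2]; ring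
    rw [← eL, e2, ← integral_const_mul, ← integral_add (hi.const_mul l) iL]
    refine integral_mono (binEntropy_tl_integrable hi) ((hi.const_mul l).add iL) fun x => ?_
    have := binEntropy_le (tl_nonneg μ x) (tl_le_one μ x) (l * x)
    linarith
  have hC : 0 < π / (2 * √3) := by positivity
  rw [← div_le_iff₀' hC]
  refine le_of_forall_gt_imp_ge_of_dense fun s hsl => ?_
  have hs0 : 0 < s := (sqrt_nonneg _).trans_lt hsl
  have hvs : mVar μ ≤ s ^ 2 := ((sqrt_lt' hs0).1 hsl).le
  rw [div_le_iff₀' hC]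
  refine (key (π / √3 / s) (by positivity)).trans ?_
  have : π / √3 / s * (mVar μ / 4) ≤ π / √3 / s * (s ^ 2 / 4) := by gcongr
  refine (add_le_add_left this _).trans (le_of_eq ?_)
  field_simp
  rw [show √3 ^ 2 = 3 by rw [sq, h33]]
  ring

/-! ### The extremal family: mixtures of the logistic law with a point mass at zero -/

noncomputable def sigS : StieltjesFunction ℝ :=
  ⟨sigmoid, sigmoid_monotone, fun _ => continuous_sigmoid.continuousWithinAt⟩

lemma sigS_apply (x : ℝ) : sigS x = sigmoid x := rfl

noncomputable def logi : Measure ℝ := sigS.measure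

instance : IsProbabilityMeasure logi :=
  sigS.isProbabilityMeasure tendsto_sigmoid_atBot tendsto_sigmoid_atTop

lemma logi_Iic (x : ℝ) : logi (Iic x) = ENNReal.ofReal (sigmoid x) := by
  rw [logi, sigS.measure_Iic tendsto_sigmoid_atBot, sigS_apply, sub_zero]

lemma logi_Ioi (x : ℝ) : logi (Ioi x) = ENNReal.ofReal (sigmoid (-x)) := by
  rw [logi, sigS.measure_Ioi tendsto_sigmoid_atTop, sigS_apply, sigmoid_neg]

lemma logi_Ici (x : ℝ) : logi (Ici x) = ENNReal.ofReal (sigmoid (-x)) := by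
  have : Function.leftLim sigS x = sigmoid x :=
    (continuous_sigmoid.continuousAt.continuousWithinAt).leftLim_eq
  rw [logi, sigS.measure_Ici tendsto_sigmoid_atTop, this, sigmoid_neg]

lemma logi_sym : Measure.map (fun x : ℝ => -x) logi = logi := by
  have : IsProbabilityMeasure (Measure.map (fun x : ℝ => -x) logi) :=
    Measure.isProbabilityMeasure_map measurable_neg.aemeasurable
  refine Measure.ext_of_Iic _ _ fun a => ?_
  rw [Measure.map_apply measurable_neg measurableSet_Iic, logi_Iic,
    show (fun x : ℝ => -x) ⁻¹' Iic a = Ici (-a) by ext x; simp [neg_le], logi_Ici, neg_neg]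

noncomputable def mixM (p : ℝ) : Measure ℝ :=
  ENNReal.ofReal (1 - p) • Measure.dirac 0 + ENNReal.ofReal p • logi

lemma mixM_prob {p : ℝ} (h0 : 0 ≤ p) (h1 : p ≤ 1) : IsProbabilityMeasure (mixM p) := by
  constructor
  simp only [mixM, Measure.add_apply, Measure.smul_apply, measure_univ, smul_eq_mul, mul_one]
  rw [← ENNReal.ofReal_add (by linarith) h0]
  simp

lemma mixM_sym (p : ℝ) : Measure.map (fun x : ℝ => -x) (mixM p) = mixM p := by
  rw [mixM, Measure.map_add _ _ measurable_neg, Measure.map_smul, Measure.map_smul, logi_sym,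
    Measure.map_dirac' measurable_neg, neg_zero]

lemma mixM_tl {p : ℝ} (h0 : 0 ≤ p) {x : ℝ} (hx : 0 < x) : tl (mixM p) x = p * sigmoid (-x) := by
  have : (0 : ℝ) ∉ Ioi x := by simp [hx.le]
  simp only [tl, mixM, Measure.add_apply, Measure.smul_apply, smul_eq_mul, logi_Ioi]
  rw [Measure.dirac_apply' _ measurableSet_Ioi, indicator_of_notMem this, mul_zero, zero_add,
    ← ENNReal.ofReal_mul h0, ENNReal.toReal_ofReal (mul_nonneg h0 (sigmoid_nonneg _))]

/-- Entropy of the mixture. -/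
noncomputable def mixE (p : ℝ) : ℝ := ∫ x in Ioi (0 : ℝ), binEntropy (p * sigmoid (-x))

lemma mixM_all {p : ℝ} (h0 : 0 ≤ p) (h1 : p ≤ 1) :
    Integrable (fun x : ℝ => x ^ 2) (mixM p) ∧ mVar (mixM p) = p * (π ^ 2 / 3) ∧
    (-∫ x : ℝ, (mixM p (Iic x)).toReal * Real.log ((mixM p (Iic x)).toReal)) = mixE p := by
  have := mixM_prob h0 h1
  obtain ⟨a1, a2⟩ := tail_sq (mixM_sym p)
  have e : EqOn (fun t => t * tl (mixM p) t) (fun t => p * (t * sigmoid (-t))) (Ioi 0) := by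
    intro t ht
    simp only [mixM_tl h0 ht]; ring
  have hi : IntegrableOn (fun t => t * tl (mixM p) t) (Ioi 0) :=
    (integrableOn_congr_fun e measurableSet_Ioi).2 (tsig_integrable.const_mul p)
  refine ⟨a1.2 hi, ?_, ?_⟩
  · rw [a2, setIntegral_congr_fun measurableSet_Ioi e, integral_const_mul, tsig_int]; ring
  · rw [entropy_eq (mixM_sym p) hi, mixE]
    refine setIntegral_congr_fun measurableSet_Ioi fun t ht => ?_
    simp only [mixM_tl h0 ht]

lemma mixE_one : mixE 1 = π ^ 2 / 6 := by
  simp only [mixE, one_mul, binEntropy_sig]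
  rw [integral_add tsig_integrable L_integrable, tsig_int, L_int]; ring

lemma mix_bd {p : ℝ} (h0 : 0 ≤ p) (h1 : p ≤ 1) {x : ℝ} (hx : 0 < x) :
    ‖binEntropy (p * sigmoid (-x))‖ ≤ x * sigmoid (-x) + log (1 + exp (-x)) := by
  have s0 := sigmoid_nonneg (-x)
  have s1 := sigmoid_le_one (-x)
  have hp0 : 0 ≤ p * sigmoid (-x) := mul_nonneg h0 s0
  have hp2 : p * sigmoid (-x) ≤ sigmoid (-x) := mul_le_of_le_one_left s0 h1
  rw [Real.norm_of_nonneg (binEntropy_nonneg hp0 (hp2.trans s1))]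
  have := binEntropy_le hp0 (hp2.trans s1) x
  have := mul_le_mul_of_nonneg_left hp2 hx.le
  linarith

lemma mixE_cont : ContinuousOn mixE (Icc 0 1) := by
  refine continuousOn_of_dominated (bound := fun x => x * sigmoid (-x) + log (1 + exp (-x)))
    ?_ ?_ (tsig_integrable.add L_integrable) ?_
  · intro p _
    exact (binEntropy_continuous.comp (by fun_prop)).aestronglyMeasurable
  · intro p hp
    filter_upwards [ae_restrict_mem measurableSet_Ioi] with x hx
    exact mix_bd hp.1 hp.2 hx
  · filter_upwards with x
    exact (binEntropy_continuous.comp (by fun_prop)).continuousOn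

lemma mixE_small : ∃ K : ℝ, 0 < K ∧ ∀ t : ℝ, 0 < t → t ≤ 1 → mixE (t ^ 4) ≤ t ^ 3 * K := by
  set K : ℝ := ∫ x in Ioi (0 : ℝ), (5 * sigmoid (-x) + binEntropy (sigmoid (-x))) with hK
  have iB : IntegrableOn (fun x => binEntropy (sigmoid (-x))) (Ioi 0) := by
    simp only [binEntropy_sig]; exact tsig_integrable.add L_integrable
  have iK : IntegrableOn (fun x => 5 * sigmoid (-x) + binEntropy (sigmoid (-x))) (Ioi 0) :=
    (sig_integrable.const_mul 5).add iB
  have hle : ∀ t : ℝ, 0 < t → t ≤ 1 → mixE (t ^ 4) ≤ t ^ 3 * K := by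
    intro t ht ht1
    rw [hK, ← integral_const_mul]
    have hi : IntegrableOn (fun x => binEntropy (t ^ 4 * sigmoid (-x))) (Ioi 0) := by
      refine (tsig_integrable.add L_integrable).mono'
        (binEntropy_continuous.comp (by fun_prop)).aestronglyMeasurable ?_
      filter_upwards [ae_restrict_mem measurableSet_Ioi] with x hx
      exact mix_bd (by positivity) (pow_le_one₀ ht.le ht1) hx
    refine integral_mono hi (iK.const_mul _) fun x => ?_
    exact binEntropy_small ht ht1 (sigmoid_pos _) (sigmoid_lt_one _)
  refine ⟨K, ?_, hle⟩
  have := hle 1 one_pos le_rfl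
  rw [one_pow, one_pow, mixE_one, one_mul] at this
  exact lt_of_lt_of_le (by positivity) this

theorem cumulative_entropy_range_symmetric :
    closure {r : ℝ | ∃ μ : Measure ℝ, IsProbabilityMeasure μ ∧
        Integrable (fun x : ℝ => x ^ 2) μ ∧ Measure.map (fun x : ℝ => -x) μ = μ ∧
        0 < Real.sqrt (mVar μ) ∧
        r = (-∫ x : ℝ, (μ (Iic x)).toReal * Real.log ((μ (Iic x)).toReal))
              / Real.sqrt (mVar μ)}
      = Icc (0 : ℝ) (π / (2 * Real.sqrt 3))
    ∧ ∀ μ : Measure ℝ, IsProbabilityMeasure μ → Integrable (fun x : ℝ => x ^ 2) μ →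
        Measure.map (fun x : ℝ => -x) μ = μ →
        (-∫ x : ℝ, (μ (Iic x)).toReal * Real.log ((μ (Iic x)).toReal))
          ≤ (π / (2 * Real.sqrt 3)) * Real.sqrt (mVar μ) := by
  have h3 : 0 < √3 := by positivity
  have h33 : √3 * √3 = 3 := mul_self_sqrt (by norm_num)
  have hC : 0 < π / (2 * √3) := by positivity
  refine ⟨?_, fun μ hp hq hs => upper hs hq⟩
  apply subset_antisymm
  · refine closure_minimal ?_ isClosed_Icc
    rintro r ⟨μ, hp, hq, hs, hpos, rfl⟩
    refine ⟨div_nonneg ?_ hpos.le, (div_le_iff₀ hpos).2 (upper hs hq)⟩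
    rw [entropy_eq hs ((tail_sq hs).1.1 hq)]
    exact integral_nonneg fun x => binEntropy_nonneg (tl_nonneg _ _) (tl_le_one _ _)
  · rw [← closure_Ioc hC.ne]
    refine closure_mono ?_
    rintro r ⟨hr0, hr1⟩
    obtain ⟨K, hK, hKb⟩ := mixE_small
    have hsq : ∀ t : ℝ, 0 < t → √(t ^ 4 * (π ^ 2 / 3)) = t ^ 2 * (π / √3) := by
      intro t ht
      rw [show t ^ 4 * (π ^ 2 / 3) = (t ^ 2 * (π / √3)) ^ 2 by
        rw [mul_pow, div_pow, sq √3, h33]; ring]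
      exact sqrt_sq (by positivity)
    set f : ℝ → ℝ := fun t => mixE (t ^ 4) / (t ^ 2 * (π / √3)) with hf
    set e : ℝ := min 1 (r * (π / √3) / K) with he
    have he0 : 0 < e := lt_min one_pos (by positivity)
    have he1 : e ≤ 1 := min_le_left _ _
    have he2 : e * K ≤ r * (π / √3) := by
      rw [← le_div_iff₀ hK]; exact min_le_right _ _
    have hcont : ContinuousOn f (Icc e 1) := by
      refine ContinuousOn.div (mixE_cont.comp (by fun_prop) ?_) (by fun_prop) ?_
      · intro t ht
        have : 0 ≤ t := he0.le.trans ht.1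
        exact ⟨by positivity, pow_le_one₀ this ht.2⟩
      · intro t ht
        have : 0 < t := he0.trans_le ht.1
        positivity
    have hfe : f e ≤ r := by
      rw [hf]; simp only
      rw [div_le_iff₀ (by positivity)]
      refine (hKb e he0 he1).trans ?_
      have := mul_le_mul_of_nonneg_left he2 (sq_nonneg e)
      linarith
    have hf1 : r ≤ f 1 := by
      refine hr1.trans (le_of_eq ?_)
      simp only [hf, one_pow, one_mul, mixE_one]
      field_simp
      rw [sq, h33]; norm_num
    obtain ⟨t, ht, rfl⟩ := intermediate_value_Icc he1 hcont ⟨hfe, hf1⟩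
    have ht0 : 0 < t := he0.trans_le ht.1
    have hp0 : 0 ≤ t ^ 4 := by positivity
    have hp1 : t ^ 4 ≤ 1 := pow_le_one₀ ht0.le ht.2
    obtain ⟨b1, b2, b3⟩ := mixM_all hp0 hp1
    refine ⟨mixM (t ^ 4), mixM_prob hp0 hp1, b1, mixM_sym _, ?_, ?_⟩
    · rw [b2, hsq t ht0]; positivity
    · rw [b2, b3, hsq t ht0]
end

section
/- Let X be a square-integrable real random variable with continuous cumulative distribution function, symmetric (X distributed as −X), and with Var X = 1. Then Δ_0(X) = −∫_ℝ F_X(x) log F_X(x) dx ≤ π/(2√3), with equality if and only if X has the logistic distribution with cumulative distribution function F(x) = 1/(1 + e^{−π x/√3}), i.e. X is distributed as (√3/π) log(U^{−1} − 1) with U uniform on (0,1). In other words, up to translation the rescaled logistic random variable is the unique maximizer of the cumulative entropy among symmetric square-integrable random variables with unit variance. -/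
open MeasureTheory Set Real

lemma gibbs_aux {p q : ℝ} (hp : 0 ≤ p) (hq : 0 < q) :
    negMulLog p + p * log q ≤ q - p ∧ (negMulLog p + p * log q = q - p → p = q) := by
  rcases hp.eq_or_lt with rfl | hp
  · simp only [negMulLog_zero, zero_mul, add_zero, sub_zero]
    exact ⟨hq.le, id⟩
  · have e : negMulLog p + p * log q = p * log (q / p) := by
      rw [log_div hq.ne' hp.ne', negMulLog]; ring
    have e2 : q - p = p * (q / p - 1) := by field_simp
    have h1 : log (q / p) ≤ q / p - 1 := log_le_sub_one_of_pos (by positivity)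
    rw [e, e2]
    refine ⟨mul_le_mul_of_nonneg_left h1 hp.le, fun h => ?_⟩
    by_contra hne
    have hne' : q / p ≠ 1 := by
      intro h'
      rw [div_eq_one_iff_eq hp.ne'] at h'
      exact hne h'.symm
    have h2 := log_lt_sub_one_of_pos (by positivity : 0 < q / p) hne'
    exact absurd (mul_left_cancel₀ hp.ne' h) h2.ne

lemma gap_aux {p : ℝ} (hp : 0 ≤ p) (hp1 : p ≤ 1) (y : ℝ) :
    negMulLog p + negMulLog (1 - p) ≤ log (1 + exp (-y)) + y * (1 - p) ∧
    (negMulLog p + negMulLog (1 - p) = log (1 + exp (-y)) + y * (1 - p) ↔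
      p = 1 / (1 + exp (-y))) := by
  have hE := exp_pos (-y)
  have h1 : 0 < 1 + exp (-y) := by positivity
  set q := 1 / (1 + exp (-y)) with hq
  have hq0 : 0 < q := by positivity
  have hq1 : 1 - q = exp (-y) / (1 + exp (-y)) := by rw [hq]; field_simp; ring
  have hq2 : 0 < 1 - q := by rw [hq1]; positivity
  have l1 : log q = - log (1 + exp (-y)) := by rw [hq, one_div, log_inv]
  have l2 : log (1 - q) = -y - log (1 + exp (-y)) := by
    rw [hq1, log_div hE.ne' h1.ne', log_exp]
  obtain ⟨a1, b1⟩ := gibbs_aux hp hq0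
  obtain ⟨a2, b2⟩ := gibbs_aux (sub_nonneg.2 hp1) hq2
  rw [l1] at a1 b1
  rw [l2] at a2 b2
  refine ⟨by nlinarith, fun h => b1 (by nlinarith), fun h => ?_⟩
  rw [h, negMulLog, negMulLog, l1, l2]; ring

lemma log_int {a : ℝ} (ha : 0 < a) :
    IntegrableOn (fun x : ℝ => log (1 + exp (-(a * x)))) (Ioi 0) ∧
    ∫ x in Ioi (0 : ℝ), log (1 + exp (-(a * x))) = π ^ 2 / (12 * a) := by
  constructor
  · have h := integrableOn_exp_mul_Ioi (a := -a) (by linarith) 0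
    refine Integrable.mono' h ?_ (ae_of_all _ fun x => ?_)
    · apply Measurable.aestronglyMeasurable; fun_prop
    · have hE := exp_pos (-(a * x))
      rw [norm_of_nonneg (log_nonneg (by linarith)), neg_mul]
      have := log_le_sub_one_of_pos (by positivity : 0 < 1 + exp (-(a * x)))
      linarith
  · let f : ℕ → ℝ → ℝ := fun n x => (-1) ^ n / ((n : ℝ) + 1) * exp (-(a * (n + 1)) * x)
    have hn : ∀ n : ℕ, -(a * ((n : ℝ) + 1)) < 0 := fun n => by
      have : 0 < a * ((n : ℝ) + 1) := by positivity
      linarith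
    have hE : ∀ n : ℕ, ∫ x in Ioi (0 : ℝ), exp (-(a * (n + 1)) * x) = 1 / (a * (n + 1)) := by
      intro n
      rw [integral_exp_mul_Ioi (hn n)]
      simp [neg_div_neg_eq]
    have hint : ∀ n, Integrable (f n) (volume.restrict (Ioi 0)) := fun n =>
      (integrableOn_exp_mul_Ioi (hn n) 0).const_mul _
    have hnorm : ∀ n, ∫ x in Ioi (0 : ℝ), ‖f n x‖ = 1 / a * (1 / ((n + 1 : ℕ) : ℝ) ^ 2) := by
      intro n
      have : ∀ x, ‖f n x‖ = 1 / ((n : ℝ) + 1) * exp (-(a * (n + 1)) * x) := by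
        intro x
        have : (0 : ℝ) < n + 1 := by positivity
        simp [f, abs_of_pos this]
      simp_rw [this]
      rw [integral_const_mul, hE]
      push_cast
      field_simp
    have hs : Summable fun n => ∫ x in Ioi (0 : ℝ), ‖f n x‖ := by
      simp_rw [hnorm]
      exact ((summable_nat_add_iff 1).2 hasSum_zeta_two.summable).mul_left _
    have H := hasSum_integral_of_summable_integral_norm hint hs
    have e1 : ∀ n, ∫ x in Ioi (0 : ℝ), f n x = 1 / a * ((-1 : ℝ) ^ n / ((n : ℝ) + 1) ^ 2) := by
      intro n
      simp only [f]
      rw [integral_const_mul, hE]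
      field_simp
    simp_rw [e1] at H
    have H2 := H.unique (alt_sum.mul_left (1 / a))
    rw [show π ^ 2 / (12 * a) = 1 / a * (π ^ 2 / 12) by field_simp, ← H2]
    refine setIntegral_congr_fun measurableSet_Ioi fun x hx => ?_
    have hx : 0 < x := hx
    have hlt : |-exp (-(a * x))| < 1 := by
      rw [abs_neg, abs_of_pos (exp_pos _), exp_lt_one_iff]
      have : 0 < a * x := by positivity
      linarith
    have h := (hasSum_pow_div_log_of_abs_lt_one hlt).neg
    rw [neg_neg, sub_neg_eq_add] at h
    rw [← h.tsum_eq]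
    congr 1
    ext n
    simp only [f]
    rw [neg_pow, ← exp_nat_mul, pow_succ]
    push_cast
    rw [show -(a * ((n : ℝ) + 1)) * x = (n + 1) * -(a * x) by ring]
    ring

lemma noatom (μ : Measure ℝ) [IsProbabilityMeasure μ]
    (hcont : Continuous fun x => (μ (Iic x)).toReal) (x : ℝ) : μ {x} = 0 := by
  have hc : Continuous (ProbabilityTheory.cdf μ) := by
    have : (ProbabilityTheory.cdf μ : ℝ → ℝ) = fun x => (μ (Iic x)).toReal := by
      ext x; rw [ProbabilityTheory.cdf_eq_real]; rfl
    rw [this]; exact hcont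
  rw [← ProbabilityTheory.measure_cdf μ, StieltjesFunction.measure_singleton,
    (hc.continuousAt.continuousWithinAt).leftLim_eq]
  simp

lemma map_neg_apply {μ : Measure ℝ} (hsym : Measure.map (fun x : ℝ => -x) μ = μ)
    {s : Set ℝ} (hs : MeasurableSet s) : μ ((fun x : ℝ => -x) ⁻¹' s) = μ s := by
  conv_rhs => rw [← hsym]
  rw [Measure.map_apply measurable_neg hs]

lemma meas_Ioi (μ : Measure ℝ) [IsProbabilityMeasure μ] (x : ℝ) :
    (μ (Ioi x)).toReal = 1 - (μ (Iic x)).toReal := by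
  have := prob_compl_eq_one_sub (μ := μ) (measurableSet_Iic (a := x))
  rw [compl_Iic] at this
  rw [this, ENNReal.toReal_sub_of_le prob_le_one (by simp)]
  simp

lemma F_neg (μ : Measure ℝ) [IsProbabilityMeasure μ]
    (hcont : Continuous fun x => (μ (Iic x)).toReal)
    (hsym : Measure.map (fun x : ℝ => -x) μ = μ) (x : ℝ) :
    (μ (Iic (-x))).toReal = 1 - (μ (Iic x)).toReal := by
  rw [← meas_Ioi, ← map_neg_apply hsym measurableSet_Iic]
  have : (fun x : ℝ => -x) ⁻¹' Iic (-x) = {x} ∪ Ioi x := by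
    ext y; simp [le_iff_eq_or_lt]
  rw [this]
  congr 1
  refine le_antisymm ((measure_union_le _ _).trans ?_) (measure_mono subset_union_right)
  rw [noatom μ hcont]; simp

lemma second_moment (μ : Measure ℝ) [IsProbabilityMeasure μ]
    (hcont : Continuous fun x => (μ (Iic x)).toReal)
    (hsym : Measure.map (fun x : ℝ => -x) μ = μ)
    (hL2 : Integrable (fun x : ℝ => x ^ 2) μ)
    (hvar : mVar μ = 1) :
    IntegrableOn (fun x : ℝ => x * (1 - (μ (Iic x)).toReal)) (Ioi 0) ∧
    ∫ x in Ioi (0 : ℝ), x * (1 - (μ (Iic x)).toReal) = 1 / 4 := by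
  have hmean : ∫ y, y ∂μ = 0 := by
    have h : ∫ y, y ∂μ = ∫ y, -y ∂μ := by
      conv_lhs => rw [← hsym]
      rw [integral_map (by fun_prop) (by fun_prop)]
    rw [integral_neg] at h
    linarith
  have h2 : ∫ x, x ^ 2 ∂μ = 1 := by
    rw [mVar, hmean] at hvar
    simpa using hvar
  have h3 : ∫⁻ x, ENNReal.ofReal (x ^ 2) ∂μ = 1 := by
    rw [← ofReal_integral_eq_lintegral_ofReal hL2 (ae_of_all _ fun x => sq_nonneg x), h2]
    simp
  have h4 := lintegral_rpow_eq_lintegral_meas_lt_mul μ (f := fun x => |x|)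
    (ae_of_all _ fun x => abs_nonneg x) (by fun_prop) (p := 2) two_pos
  have h5 : ∀ x : ℝ, |x| ^ (2 : ℝ) = x ^ 2 := fun x => by
    rw [show (2 : ℝ) = ((2 : ℕ) : ℝ) by norm_num, rpow_natCast, sq_abs]
  simp only [h5] at h4
  rw [h3] at h4
  have h6 : ∫⁻ t in Ioi (0 : ℝ), μ {a : ℝ | t < |a|} * ENNReal.ofReal (t ^ ((2 : ℝ) - 1))
      = ∫⁻ t in Ioi (0 : ℝ), 2 * ENNReal.ofReal (t * (1 - (μ (Iic t)).toReal)) := by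
    refine setLIntegral_congr_fun measurableSet_Ioi fun t ht => ?_
    have ht : 0 < t := ht
    have hset : {a : ℝ | t < |a|} = Ioi t ∪ (fun x : ℝ => -x) ⁻¹' (Ioi t) := by
      ext a; simp [lt_abs, lt_neg]
    have hdis : Disjoint (Ioi t) ((fun x : ℝ => -x) ⁻¹' (Ioi t)) := by
      rw [Set.disjoint_left]
      intro a ha hb
      simp only [mem_Ioi, mem_preimage] at ha hb
      linarith
    have hm : μ {a : ℝ | t < |a|} = 2 * μ (Ioi t) := by
      rw [hset, measure_union hdis (measurable_neg measurableSet_Ioi),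
        map_neg_apply hsym measurableSet_Ioi, two_mul]
    rw [hm, ← meas_Ioi, ENNReal.ofReal_mul ht.le, ENNReal.ofReal_toReal (measure_ne_top _ _),
      show (2 : ℝ) - 1 = 1 by norm_num, rpow_one, mul_assoc, mul_comm (μ _)]
  have hmeas : Measurable fun t : ℝ => t * (1 - (μ (Iic t)).toReal) :=
    (continuous_id.mul (continuous_const.sub hcont)).measurable
  rw [h6, lintegral_const_mul _ hmeas.ennreal_ofReal] at h4
  set L := ∫⁻ t in Ioi (0 : ℝ), ENNReal.ofReal (t * (1 - (μ (Iic t)).toReal)) with hL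
  have hnn : 0 ≤ᵐ[volume.restrict (Ioi (0 : ℝ))] fun t : ℝ => t * (1 - (μ (Iic t)).toReal) := by
    refine (ae_restrict_iff' measurableSet_Ioi).2 (ae_of_all _ fun t ht => ?_)
    have ht : 0 < t := ht
    simp only [Pi.zero_apply]
    rw [← meas_Ioi]; positivity
  have hLt : L ≠ ⊤ := by
    intro h
    rw [h] at h4
    simp at h4
  have h7 := congrArg ENNReal.toReal h4
  simp only [ENNReal.toReal_mul, ENNReal.toReal_one] at h7
  refine ⟨?_, ?_⟩
  · refine ⟨hmeas.aestronglyMeasurable, ?_⟩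
    rw [hasFiniteIntegral_iff_ofReal hnn]
    exact hLt.lt_top
  · rw [integral_eq_lintegral_of_nonneg_ae hnn hmeas.aestronglyMeasurable, ← hL]
    norm_num at h7
    linarith

/-- For a square-integrable symmetric real random variable `X`
(with law `μ`) with continuous cdf and unit variance, the cumulative entropy satisfies
`Δ_0(X) = −∫ F log F ≤ π/(2√3)`, with equality iff `X` has the logistic distribution with
cdf `F(x) = 1/(1 + e^{−πx/√3})`. -/
theorem logistic_maximizes_cumulative_entropy (μ : Measure ℝ) [IsProbabilityMeasure μ]
    (hcont : Continuous fun x => (μ (Iic x)).toReal)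
    (hsym : Measure.map (fun x : ℝ => -x) μ = μ)
    (hL2 : Integrable (fun x : ℝ => x ^ 2) μ)
    (hvar : mVar μ = 1) :
    (-∫ x : ℝ, (μ (Iic x)).toReal * Real.log ((μ (Iic x)).toReal)) ≤ π / (2 * Real.sqrt 3)
    ∧ ((-∫ x : ℝ, (μ (Iic x)).toReal * Real.log ((μ (Iic x)).toReal)) = π / (2 * Real.sqrt 3)
        ↔ ∀ x : ℝ, (μ (Iic x)).toReal = 1 / (1 + Real.exp (-(π * x / Real.sqrt 3)))) := by
  obtain ⟨hMi, hM⟩ := second_moment μ hcont hsym hL2 hvar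
  have hFneg := F_neg μ hcont hsym
  have hF0 : ∀ x, 0 ≤ (μ (Iic x)).toReal := fun x => ENNReal.toReal_nonneg
  have hF1 : ∀ x, (μ (Iic x)).toReal ≤ 1 := fun x => by
    have := meas_Ioi μ x
    have h : 0 ≤ (μ (Ioi x)).toReal := ENNReal.toReal_nonneg
    linarith
  set F : ℝ → ℝ := fun x => (μ (Iic x)).toReal with hF
  have hs3 : 0 < √(3 : ℝ) := by positivity
  have hs3' : √(3 : ℝ) * √3 = 3 := mul_self_sqrt (by norm_num)
  set a : ℝ := π / √3 with ha
  have ha0 : 0 < a := by positivity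
  obtain ⟨hLi, hL⟩ := log_int ha0
  have hax : ∀ x, π * x / √3 = a * x := fun x => by rw [ha]; ring
  simp only [hax]
  change (-∫ x : ℝ, F x * log (F x)) ≤ _ ∧ ((-∫ x : ℝ, F x * log (F x)) = _ ↔
    ∀ x : ℝ, F x = _)
  change ∀ x, F (-x) = 1 - F x at hFneg
  change ∀ x, 0 ≤ F x at hF0
  change ∀ x, F x ≤ 1 at hF1
  change IntegrableOn (fun x : ℝ => x * (1 - F x)) (Ioi 0) at hMi
  change ∫ x in Ioi (0 : ℝ), x * (1 - F x) = 1 / 4 at hM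
  clear_value F
  let B : ℝ → ℝ := fun x => log (1 + exp (-(a * x))) + a * (x * (1 - F x))
  have hBi : IntegrableOn B (Ioi 0) := hLi.add (hMi.const_mul a)
  have hBv : ∫ x in Ioi (0 : ℝ), B x = π / (2 * √3) := by
    simp only [B]
    rw [integral_add hLi (hMi.const_mul a), integral_const_mul, hL, hM, ha]
    field_simp
    nlinarith [pi_pos]
  have hn0 : ∀ x, 0 ≤ negMulLog (F x) := fun x => negMulLog_nonneg (hF0 x) (hF1 x)
  have hn1 : ∀ x, 0 ≤ negMulLog (1 - F x) := fun x =>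
    negMulLog_nonneg (by linarith [hF1 x]) (by linarith [hF0 x])
  have hgap : ∀ x, negMulLog (F x) + negMulLog (1 - F x) ≤ B x ∧
      (negMulLog (F x) + negMulLog (1 - F x) = B x ↔ F x = 1 / (1 + exp (-(a * x)))) := by
    intro x
    have := gap_aux (hF0 x) (hF1 x) (a * x)
    simp only [B]
    rwa [← mul_assoc]
  have hc0 : Continuous fun x => negMulLog (F x) := continuous_negMulLog.comp hcont
  have hc1 : Continuous fun x => negMulLog (1 - F x) :=
    continuous_negMulLog.comp (continuous_const.sub hcont)
  have hi0 : IntegrableOn (fun x => negMulLog (F x)) (Ioi 0) :=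
    Integrable.mono' hBi hc0.aestronglyMeasurable (ae_of_all _ fun x => by
      rw [norm_of_nonneg (hn0 x)]; linarith [(hgap x).1, hn1 x])
  have hi1 : IntegrableOn (fun x => negMulLog (1 - F x)) (Ioi 0) :=
    Integrable.mono' hBi hc1.aestronglyMeasurable (ae_of_all _ fun x => by
      rw [norm_of_nonneg (hn1 x)]; linarith [(hgap x).1, hn0 x])
  have hi2 : IntegrableOn (fun x => negMulLog (F x)) (Iic 0) := by
    rw [integrableOn_Iic_iff_integrableOn_Iio]
    have h := IntegrableOn.comp_neg_Iio (c := 0) (f := fun x => negMulLog (1 - F x))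
      (by simpa using hi1)
    refine h.congr_fun (fun x _ => ?_) measurableSet_Iio
    simp only [hFneg]
    congr 1; ring
  have hD : (-∫ x : ℝ, F x * log (F x)) =
      ∫ x in Ioi (0 : ℝ), (negMulLog (F x) + negMulLog (1 - F x)) := by
    have e : (-∫ x : ℝ, F x * log (F x)) = ∫ x : ℝ, negMulLog (F x) := by
      rw [← integral_neg]; simp [negMulLog]
    rw [e, ← intervalIntegral.integral_Iic_add_Ioi hi2 hi0, integral_add hi0 hi1, add_comm]
    congr 1
    have h := integral_comp_neg_Ioi 0 fun x => negMulLog (F x)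
    rw [neg_zero] at h
    rw [← h]
    simp only [hFneg]
  have hle : ∫ x in Ioi (0 : ℝ), (negMulLog (F x) + negMulLog (1 - F x)) ≤
      ∫ x in Ioi (0 : ℝ), B x :=
    integral_mono (hi0.add hi1) hBi fun x => (hgap x).1
  rw [hD, ← hBv]
  refine ⟨hle, fun h => ?_, fun h => ?_⟩
  · have hz : ∫ x in Ioi (0 : ℝ), (B x - (negMulLog (F x) + negMulLog (1 - F x))) = 0 := by
      have h1 := integral_sub (μ := volume.restrict (Ioi (0 : ℝ))) hBi (hi0.add hi1)
      simp only [Pi.add_apply] at h1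
      rw [h1, h, sub_self]
    have hae := (setIntegral_eq_zero_iff_of_nonneg_ae
      (ae_of_all _ fun x => sub_nonneg.2 (hgap x).1) (hBi.sub (hi0.add hi1))).1 hz
    have hBc : Continuous B := by
      refine Continuous.add (Continuous.log (by fun_prop) fun x => ?_)
        (continuous_const.mul (continuous_id.mul (continuous_const.sub hcont)))
      positivity
    have heq := Measure.eqOn_open_of_ae_eq hae isOpen_Ioi
      (hBc.sub (hc0.add hc1)).continuousOn continuous_const.continuousOn
    have hpos : ∀ x, 0 < x → F x = 1 / (1 + exp (-(a * x))) := fun x hx => by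
      have h1 : B x - (negMulLog (F x) + negMulLog (1 - F x)) = 0 := heq hx
      exact (hgap x).2.1 (by linarith)
    intro x
    rcases lt_trichotomy x 0 with hx | rfl | hx
    · have h1 := hpos (-x) (by linarith)
      rw [hFneg] at h1
      have h2 : F x = 1 - 1 / (1 + exp (-(a * -x))) := by linarith
      rw [h2, show -(a * -x) = a * x by ring, exp_neg]
      have := exp_pos (a * x)
      field_simp
      ring
    · have h1 := hFneg 0
      rw [neg_zero] at h1
      simp
      linarith
    · exact hpos x hx
  · congr 1
    ext x
    exact (hgap x).2.2 (h x)
end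

section
/- For every real number s ≥ −3/2, one has Γ(s+2)² / Γ(2s+1) ≥ 1 + 2s − s², where Γ is the Gamma function. Moreover the inequality is strict for every s ≥ −3/2 with s ∉ {0, 1}. -/
open Real

/-- Rolle's theorem on an open interval. -/
lemma gri_rolle {a b : ℝ} {f f' : ℝ → ℝ} (h : ∀ t, a < t → t < b → HasDerivAt f (f' t) t)
    {x y : ℝ} (hx : a < x) (hxy : x < y) (hy : y < b) (fx : f x = 0) (fy : f y = 0) :
    ∃ z, x < z ∧ z < y ∧ f' z = 0 := by
  obtain ⟨c, hc, h0⟩ := exists_hasDerivAt_eq_zero (f := f) (f' := f') hxy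
    (fun t ht => (h t (by linarith [ht.1]) (by linarith [ht.2])).continuousAt.continuousWithinAt)
    (by rw [fx, fy]) (fun t ht => h t (by linarith [ht.1]) (by linarith [ht.2]))
  exact ⟨c, hc.1, hc.2, h0⟩

lemma gri_rolle3 {a b : ℝ} {f1 f2 f3 f4 : ℝ → ℝ}
    (h1 : ∀ t, a < t → t < b → HasDerivAt f1 (f2 t) t)
    (h2 : ∀ t, a < t → t < b → HasDerivAt f2 (f3 t) t)
    (h3 : ∀ t, a < t → t < b → HasDerivAt f3 (f4 t) t)
    {p q r s : ℝ} (hp : a < p) (hpq : p < q) (hqr : q < r) (hrs : r < s) (hs : s < b)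
    (fp : f1 p = 0) (fq : f1 q = 0) (fr : f1 r = 0) (fs : f1 s = 0) :
    ∃ z, a < z ∧ z < b ∧ f4 z = 0 := by
  obtain ⟨x, _, _, hx⟩ := gri_rolle h1 hp hpq (by linarith) fp fq
  obtain ⟨y, _, _, hy⟩ := gri_rolle h1 (by linarith) hqr (by linarith) fq fr
  obtain ⟨z, _, _, hz⟩ := gri_rolle h1 (by linarith) hrs (by linarith) fr fs
  obtain ⟨u, _, _, hu⟩ := gri_rolle h2 (x := x) (y := y) (by linarith) (by linarith)
    (by linarith) hx hy
  obtain ⟨v, _, _, hv⟩ := gri_rolle h2 (x := y) (y := z) (by linarith) (by linarith)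
    (by linarith) hy hz
  obtain ⟨w, _, _, hw⟩ := gri_rolle h3 (x := u) (y := v) (by linarith) (by linarith)
    (by linarith) hu hv
  exact ⟨w, by linarith, by linarith, hw⟩

/-- Error in cubic Hermite interpolation at `0` and `1`. -/
lemma gri_hermite {a b : ℝ} (ha : a < 0) (hb : 1 < b) {G G1 G2 G3 G4 : ℝ → ℝ} {c : ℝ}
    (h0 : ∀ t, a < t → t < b → HasDerivAt G (G1 t) t)
    (h1 : ∀ t, a < t → t < b → HasDerivAt G1 (G2 t) t)
    (h2 : ∀ t, a < t → t < b → HasDerivAt G2 (G3 t) t)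
    (h3 : ∀ t, a < t → t < b → HasDerivAt G3 (G4 t) t)
    (h4 : ∀ t, a < t → t < b → c ≤ G4 t) {s : ℝ} (hs : a < s) (hs' : s < b)
    (s0 : s ≠ 0) (s1 : s ≠ 1) :
    G 0 * (1 - 3 * s ^ 2 + 2 * s ^ 3) + G 1 * (3 * s ^ 2 - 2 * s ^ 3)
      + G1 0 * (s - 2 * s ^ 2 + s ^ 3) + G1 1 * (s ^ 3 - s ^ 2)
      + c / 24 * (s ^ 2 * (s - 1) ^ 2) ≤ G s := by
  have hpos : 0 < s ^ 2 * (s - 1) ^ 2 := by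
    have := sub_ne_zero.mpr s1
    positivity
  set R := G s - (G 0 * (1 - 3 * s ^ 2 + 2 * s ^ 3) + G 1 * (3 * s ^ 2 - 2 * s ^ 3)
      + G1 0 * (s - 2 * s ^ 2 + s ^ 3) + G1 1 * (s ^ 3 - s ^ 2)) with hR
  obtain ⟨K, hK⟩ : ∃ K, K * (s ^ 2 * (s - 1) ^ 2) = R := ⟨R / _, div_mul_cancel₀ _ hpos.ne'⟩
  obtain ⟨c0, hc0⟩ : ∃ x, x = G 0 := ⟨_, rfl⟩
  obtain ⟨c1, hc1⟩ : ∃ x, x = G1 0 := ⟨_, rfl⟩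
  obtain ⟨c2, hc2⟩ : ∃ x, x = -3 * G 0 + 3 * G 1 - 2 * G1 0 - G1 1 + K := ⟨_, rfl⟩
  obtain ⟨c3, hc3⟩ : ∃ x, x = 2 * G 0 - 2 * G 1 + G1 0 + G1 1 - 2 * K := ⟨_, rfl⟩
  have pw : ∀ (k : ℕ) (t : ℝ), HasDerivAt (fun t : ℝ => t ^ k) (k * t ^ (k - 1)) t :=
    fun k t => hasDerivAt_pow k t
  have d0 : ∀ t, a < t → t < b → HasDerivAt
      (fun t => G t - (c0 + c1 * t + c2 * t ^ 2 + c3 * t ^ 3 + K * t ^ 4))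
      (G1 t - (c1 + 2 * c2 * t + 3 * c3 * t ^ 2 + 4 * K * t ^ 3)) t := by
    intro t ht ht'
    refine ((h0 t ht ht').sub ((((((hasDerivAt_id t).const_mul c1).const_add c0).add
      ((pw 2 t).const_mul c2)).add ((pw 3 t).const_mul c3)).add ((pw 4 t).const_mul K))).congr_deriv ?_
    norm_num; ring
  have d1 : ∀ t, a < t → t < b → HasDerivAt
      (fun t => G1 t - (c1 + 2 * c2 * t + 3 * c3 * t ^ 2 + 4 * K * t ^ 3))
      (G2 t - (2 * c2 + 6 * c3 * t + 12 * K * t ^ 2)) t := by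
    intro t ht ht'
    refine ((h1 t ht ht').sub (((((hasDerivAt_id t).const_mul (2 * c2)).const_add c1).add
      ((pw 2 t).const_mul (3 * c3))).add ((pw 3 t).const_mul (4 * K)))).congr_deriv ?_
    norm_num; ring
  have d2 : ∀ t, a < t → t < b → HasDerivAt
      (fun t => G2 t - (2 * c2 + 6 * c3 * t + 12 * K * t ^ 2))
      (G3 t - (6 * c3 + 24 * K * t)) t := by
    intro t ht ht'
    refine ((h2 t ht ht').sub ((((hasDerivAt_id t).const_mul (6 * c3)).const_add (2 * c2)).add
      ((pw 2 t).const_mul (12 * K)))).congr_deriv ?_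
    norm_num; ring
  have d3 : ∀ t, a < t → t < b → HasDerivAt
      (fun t => G3 t - (6 * c3 + 24 * K * t)) (G4 t - 24 * K) t := by
    intro t ht ht'
    refine ((h3 t ht ht').sub (((hasDerivAt_id t).const_mul (24 * K)).const_add (6 * c3))).congr_deriv ?_
    norm_num
  have z0 : (fun t => G t - (c0 + c1 * t + c2 * t ^ 2 + c3 * t ^ 3 + K * t ^ 4)) 0 = 0 := by
    simp [hc0]
  have z1 : (fun t => G t - (c0 + c1 * t + c2 * t ^ 2 + c3 * t ^ 3 + K * t ^ 4)) 1 = 0 := by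
    simp only [hc0, hc1, hc2, hc3]; ring
  have zs : (fun t => G t - (c0 + c1 * t + c2 * t ^ 2 + c3 * t ^ 3 + K * t ^ 4)) s = 0 := by
    simp only [hc0, hc1, hc2, hc3]
    linear_combination -hK + hR
  have w0 : (fun t => G1 t - (c1 + 2 * c2 * t + 3 * c3 * t ^ 2 + 4 * K * t ^ 3)) 0 = 0 := by
    simp [hc1]
  have w1 : (fun t => G1 t - (c1 + 2 * c2 * t + 3 * c3 * t ^ 2 + 4 * K * t ^ 3)) 1 = 0 := by
    simp only [hc1, hc2, hc3]; ring
  have key : ∃ z, a < z ∧ z < b ∧ G4 z - 24 * K = 0 := by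
    rcases lt_or_gt_of_ne s0 with hlt | hgt
    · obtain ⟨x, _, _, hx⟩ := gri_rolle d0 hs hlt (by linarith) zs z0
      obtain ⟨y, _, _, hy⟩ := gri_rolle d0 ha one_pos hb z0 z1
      exact gri_rolle3 d1 d2 d3 (p := x) (q := 0) (r := y) (s := 1) (by linarith) (by linarith)
        (by linarith) (by linarith) hb hx w0 hy w1
    · rcases lt_or_gt_of_ne s1 with hlt1 | hgt1
      · obtain ⟨x, _, _, hx⟩ := gri_rolle d0 ha hgt (by linarith) z0 zs
        obtain ⟨y, _, _, hy⟩ := gri_rolle d0 hs hlt1 hb zs z1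
        exact gri_rolle3 d1 d2 d3 (p := 0) (q := x) (r := y) (s := 1) (by linarith) (by linarith)
          (by linarith) (by linarith) hb w0 hx hy w1
      · obtain ⟨x, _, _, hx⟩ := gri_rolle d0 ha one_pos hb z0 z1
        obtain ⟨y, _, _, hy⟩ := gri_rolle d0 (by linarith) hgt1 hs' z1 zs
        exact gri_rolle3 d1 d2 d3 (p := 0) (q := x) (r := 1) (s := y) (by linarith) (by linarith)
          (by linarith) (by linarith) (by linarith) w0 hx w1 hy
  obtain ⟨z, hz, hz', hzK⟩ := key
  have hcK : c / 24 ≤ K := by linarith [h4 z hz hz']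
  have := mul_le_mul_of_nonneg_right hcK hpos.le
  linarith

/-- Comparison of inverse fourth powers. -/
lemma gri_inv4 {x y : ℝ} (hx : 0 < x) (h : x ≤ y) : 1 / y ^ 4 ≤ 1 / x ^ 4 := by
  gcongr

lemma gri_tangent {z d : ℝ} (hz : 0 < z) (hd : 0 ≤ d) :
    1 / (z + d) ^ 4 + 4 * d / (z + d) ^ 5 ≤ 1 / z ^ 4 := by
  have h : 1 / (z + d) ^ 4 + 4 * d / (z + d) ^ 5 = (z + 5 * d) / (z + d) ^ 5 := by
    field_simp; ring
  rw [h, div_le_div_iff₀ (by positivity) (by positivity)]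
  have : 0 ≤ 10 * z ^ 3 * d ^ 2 + 10 * z ^ 2 * d ^ 3 + 5 * z * d ^ 4 + d ^ 5 := by positivity
  nlinarith [this]

lemma gri_step {y : ℝ} (hy : 1 / 2 < y) :
    1 / (y - 1 / 4) ^ 4 - 1 / (y + 1 / 4) ^ 4
      ≤ 1 / 2 * (1 / (y - 1 / 2) ^ 4 - 1 / (y + 1 / 2) ^ 4) := by
  have h1 : 0 < y - 1 / 2 := by linarith
  have h2 : 0 < y - 1 / 4 := by linarith
  have h3 : 0 < y + 1 / 4 := by linarith
  have h4 : 0 < y + 1 / 2 := by linarith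
  have e1 : 1 / (y - 1 / 4) ^ 4 - 1 / (y + 1 / 4) ^ 4
      = 2 * y * (y ^ 2 + 1 / 16) / ((y - 1 / 4) * (y + 1 / 4)) ^ 4 := by
    rw [mul_pow, div_sub_div _ _ (by positivity) (by positivity)]
    congr 1; ring
  have e2 : 1 / 2 * (1 / (y - 1 / 2) ^ 4 - 1 / (y + 1 / 2) ^ 4)
      = 2 * y * (y ^ 2 + 1 / 4) / ((y - 1 / 2) * (y + 1 / 2)) ^ 4 := by
    rw [mul_pow, div_sub_div _ _ (by positivity) (by positivity), ← mul_div_assoc]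
    congr 1; ring
  rw [e1, e2]
  have h5 : (y - 1 / 2) * (y + 1 / 2) ≤ (y - 1 / 4) * (y + 1 / 4) := by nlinarith
  have h6 : 0 < (y - 1 / 2) * (y + 1 / 2) := by positivity
  have h7 : 0 < y := by linarith
  gcongr
  norm_num

lemma gri_tele {s : ℝ} (hs : -(1 / 2) < s) (n : ℕ) :
    ∑ m ∈ Finset.range n, (1 / (s + m + 3 / 2) ^ 4 - 1 / (s + m + 2) ^ 4)
      ≤ 1 / 2 * (1 / (s + 5 / 4) ^ 4 - 1 / (s + n + 5 / 4) ^ 4) := by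
  induction n with
  | zero => simp
  | succ n ih =>
    rw [Finset.sum_range_succ]
    have hn : (0 : ℝ) ≤ n := n.cast_nonneg
    have := gri_step (y := s + n + 7 / 4) (by linarith)
    rw [show s + n + 7 / 4 - 1 / 4 = s + n + 3 / 2 by ring,
      show s + n + 7 / 4 + 1 / 4 = s + n + 2 by ring,
      show s + n + 7 / 4 - 1 / 2 = s + n + 5 / 4 by ring,
      show s + n + 7 / 4 + 1 / 2 = s + (n + 1 : ℝ) + 5 / 4 by ring] at this
    push_cast
    linarith

lemma gri_half {s : ℝ} (hs : -(1 / 2) < s) (n : ℕ) :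
    ∑ m ∈ Finset.range (2 * n), 1 / (s + (m + 1) / 2) ^ 4
      = ∑ m ∈ Finset.range n, (1 / (s + m + 1 / 2) ^ 4 + 1 / (s + m + 1) ^ 4) := by
  induction n with
  | zero => simp
  | succ n ih =>
    rw [Finset.sum_range_succ, ← ih, show 2 * (n + 1) = 2 * n + 1 + 1 by ring,
      Finset.sum_range_succ, Finset.sum_range_succ]
    push_cast
    rw [show s + (2 * (n : ℝ) + 1) / 2 = s + n + 1 / 2 by ring,
      show s + (2 * (n : ℝ) + 1 + 1) / 2 = s + n + 1 by ring]
    ring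

lemma gri_sum {s : ℝ} (hs : -(1 / 2) < s) (n : ℕ) :
    -(1 / (s + 1 / 2) ^ 4) - 1 / (s + 1) ^ 4 - 1 / 2 * (1 / (s + 5 / 4) ^ 4)
      ≤ ∑ m ∈ Finset.range n, (2 * (1 / (s + m + 2) ^ 4) - 1 / (s + (m + 1) / 2) ^ 4) := by
  have h1 : ∑ m ∈ Finset.range n, 1 / (s + (m + 1) / 2) ^ 4
      ≤ ∑ m ∈ Finset.range (2 * (n + 1)), 1 / (s + (m + 1) / 2) ^ 4 := by
    apply Finset.sum_le_sum_of_subset_of_nonneg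
    · exact Finset.range_subset_range.mpr (by omega)
    · intros
      apply div_nonneg zero_le_one
      exact Even.pow_nonneg (by decide) _
  rw [gri_half hs, Finset.sum_range_succ'] at h1
  have h2 := gri_tele hs n
  have h3 : 0 ≤ 1 / 2 * (1 / (s + n + 5 / 4) ^ 4) := by positivity
  have h4 : ∑ m ∈ Finset.range n, (1 / (s + (m + 1 : ℕ) + 1 / 2) ^ 4 + 1 / (s + (m + 1 : ℕ) + 1) ^ 4)
     = ∑ m ∈ Finset.range n, (1 / (s + m + 3 / 2) ^ 4 - 1 / (s + m + 2) ^ 4)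
      + ∑ m ∈ Finset.range n, 2 * (1 / (s + m + 2) ^ 4) := by
    rw [← Finset.sum_add_distrib]
    refine Finset.sum_congr rfl fun m _ => ?_
    push_cast
    rw [show s + ((m : ℝ) + 1) + 1 / 2 = s + m + 3 / 2 by ring,
      show s + ((m : ℝ) + 1) + 1 = s + m + 2 by ring]
    ring
  rw [h4] at h1
  rw [Finset.sum_sub_distrib]
  simp only [Nat.cast_zero, add_zero] at h1
  linarith

lemma gri_piece {v l r : ℝ} (hl : 0 < l) (hlv : l ≤ v) (hvr : v ≤ r) (hr : r ≤ 2)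
    (h : 1 / (l + 1 / 2) ^ 4 + 1 / 2 * (1 / (l + 3 / 4) ^ 4) + 1 / 50
      ≤ 343 / 1000 / r ^ 5 + 1 / (291422 / 100000 - l) ^ 4) :
    1 / (v + 1 / 2) ^ 4 + 1 / 2 * (1 / (v + 3 / 4) ^ 4) + 1 / 50
      ≤ 343 / 1000 / v ^ 5 + 1 / (291422 / 100000 - v) ^ 4 := by
  have h1 : 1 / (v + 1 / 2) ^ 4 ≤ 1 / (l + 1 / 2) ^ 4 := gri_inv4 (by linarith) (by linarith)
  have h2 : 1 / (v + 3 / 4) ^ 4 ≤ 1 / (l + 3 / 4) ^ 4 := gri_inv4 (by linarith) (by linarith)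
  have h3 : 1 / (291422 / 100000 - l) ^ 4 ≤ 1 / (291422 / 100000 - v) ^ 4 :=
    gri_inv4 (by linarith) (by linarith)
  have h4 : 343 / 1000 / r ^ 5 ≤ 343 / 1000 / v ^ 5 := by
    have : 0 < v := by linarith
    gcongr
  linarith

lemma gri_num {v : ℝ} (h0 : 8 / 100 < v) (h1 : v < 291422 / 100000) :
    1 / (v + 1 / 2) ^ 4 + 1 / 2 * (1 / (v + 3 / 4) ^ 4) + 1 / 50
      ≤ 343 / 1000 / v ^ 5 + 1 / (291422 / 100000 - v) ^ 4 := by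
  rcases le_total v (50 / 100) with a | a
  · exact gri_piece (by norm_num) h0.le a (by norm_num) (by norm_num)
  rcases le_total v (77 / 100) with b | b
  · exact gri_piece (by norm_num) a b (by norm_num) (by norm_num)
  rcases le_total v (94 / 100) with c | c
  · exact gri_piece (by norm_num) b c (by norm_num) (by norm_num)
  rcases le_total v (106 / 100) with d | d
  · exact gri_piece (by norm_num) c d (by norm_num) (by norm_num)
  rcases le_total v (117 / 100) with e | e
  · exact gri_piece (by norm_num) d e (by norm_num) (by norm_num)
  rcases le_total v (134 / 100) with f | f
  · exact gri_piece (by norm_num) e f (by norm_num) (by norm_num)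
  rcases le_total v (150 / 100) with g | g
  · exact gri_piece (by norm_num) f g (by norm_num) (by norm_num)
  have h2 : 1 / (v + 1 / 2) ^ 4 ≤ 1 / 2 ^ 4 := gri_inv4 (by norm_num) (by linarith)
  have h3 : 1 / (v + 3 / 4) ^ 4 ≤ 1 / 2 ^ 4 := gri_inv4 (by norm_num) (by linarith)
  have h4 : 1 / (3 / 2) ^ 4 ≤ 1 / (291422 / 100000 - v) ^ 4 :=
    gri_inv4 (by linarith) (by linarith)
  have h5 : 0 ≤ 343 / 1000 / v ^ 5 := by
    have : 0 < v := by linarith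
    positivity
  norm_num at h2 h3 h4 ⊢
  norm_num at h5
  linarith

lemma gri_sqrt : (1.4142 : ℝ) < √2 ∧ √2 < 1.41422 := by
  constructor
  · rw [Real.lt_sqrt (by norm_num)]; norm_num
  · rw [Real.sqrt_lt' (by norm_num)]; norm_num

lemma gri_fourth {s : ℝ} (h0 : 1 - √2 < s) (h1 : s < 1 + √2) (n : ℕ) :
    1 / 50 ≤ ∑ m ∈ Finset.range n, (2 * (1 / (s + m + 2) ^ 4) - 1 / (s + (m + 1) / 2) ^ 4)
      + 1 / (s + (√2 - 1)) ^ 4 + 1 / (√2 + 1 - s) ^ 4 := by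
  obtain ⟨q1, q2⟩ := gri_sqrt
  norm_num at q1 q2
  have hs : -(1 / 2) < s := by linarith
  have a1 := gri_sum hs n
  have a2 := gri_tangent (z := s + (√2 - 1)) (d := 3 / 2 - √2) (by linarith) (by linarith)
  rw [show s + (√2 - 1) + (3 / 2 - √2) = s + 1 / 2 by ring] at a2
  have a3 : 343 / 1000 / (s + 1 / 2) ^ 5 ≤ 4 * (3 / 2 - √2) / (s + 1 / 2) ^ 5 := by
    have : 0 < s + 1 / 2 := by linarith
    gcongr
    linarith
  have a4 := gri_num (v := s + 1 / 2) (by linarith) (by linarith)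
  rw [show s + 1 / 2 + 1 / 2 = s + 1 by ring, show s + 1 / 2 + 3 / 4 = s + 5 / 4 by ring] at a4
  have a5 : 1 / (291422 / 100000 - (s + 1 / 2)) ^ 4 ≤ 1 / (√2 + 1 - s) ^ 4 :=
    gri_inv4 (by linarith) (by linarith)
  linarith

lemma gri_dpow (c a b : ℝ) (k : ℕ) (t : ℝ) (h : a * t + b ≠ 0) :
    HasDerivAt (fun t => c / (a * t + b) ^ k) (-(k * a * c) / (a * t + b) ^ (k + 1)) t := by
  have h1 : HasDerivAt (fun t => a * t + b) a t := by
    simpa using ((hasDerivAt_id t).const_mul a).add_const b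
  have h2 := (hasDerivAt_const t c).div (h1.pow k) (pow_ne_zero k h)
  refine h2.congr_deriv ?_
  cases k with
  | zero => simp
  | succ k =>
    simp only [Nat.add_sub_cancel, Pi.pow_apply]
    field_simp
    push_cast
    ring

lemma gri_dlog (a b : ℝ) (t : ℝ) (h : a * t + b ≠ 0) :
    HasDerivAt (fun t => log (a * t + b)) (a / (a * t + b)) t := by
  have h1 : HasDerivAt (fun t => a * t + b) a t := by
    simpa using ((hasDerivAt_id t).const_mul a).add_const b
  exact h1.log h

lemma gri_sum_deriv {n : ℕ} {F F' : ℕ → ℝ → ℝ} {g1 g2 : ℝ → ℝ} {g1' g2' : ℝ} {t : ℝ}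
    (h : ∀ m, HasDerivAt (F m) (F' m t) t) (h1 : HasDerivAt g1 g1' t) (h2 : HasDerivAt g2 g2' t) :
    HasDerivAt (fun t => ∑ m ∈ Finset.range n, F m t + g1 t + g2 t)
      (∑ m ∈ Finset.range n, F' m t + g1' + g2') t :=
  ((HasDerivAt.fun_sum fun m _ => h m).add h1).add h2

lemma gri_log (s : ℝ) (hs : 1 - √2 < s) (hs' : s < 1 + √2) (s0 : s ≠ 0) (s1 : s ≠ 1) :
    0 < 2 * log (Gamma (s + 2)) - log (Gamma (2 * s + 1))
      - log (s + (√2 - 1)) - log (√2 + 1 - s) := by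
  obtain ⟨q1, q2⟩ := gri_sqrt
  norm_num at q1 q2
  have qq : √2 * √2 = 2 := Real.mul_self_sqrt (by norm_num)
  let L : ℕ → ℝ → ℝ := fun n t =>
    2 * BohrMollerup.logGammaSeq (t + 2) n - BohrMollerup.logGammaSeq (2 * t + 1) n
      - log (t + (√2 - 1)) - log (√2 + 1 - t)
  have lim : ∀ t, 1 - √2 < t → Filter.Tendsto (fun n => L n t) Filter.atTop (nhds
      (2 * log (Gamma (t + 2)) - log (Gamma (2 * t + 1))
      - log (t + (√2 - 1)) - log (√2 + 1 - t))) := by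
    intro t ht
    exact ((((BohrMollerup.tendsto_log_gamma (x := t + 2) (by linarith)).const_mul 2).sub
      (BohrMollerup.tendsto_log_gamma (x := 2 * t + 1) (by linarith))).sub_const _).sub_const _
  have lim0 : Filter.Tendsto (fun n => L n 0) Filter.atTop (nhds 0) := by
    convert lim 0 (by linarith) using 2
    have : log (√2 - 1) + log (√2 + 1) = 0 := by
      rw [← log_mul (by linarith) (by linarith), show (√2 - 1) * (√2 + 1) = 1 by linarith, log_one]
    simp [Gamma_two]
    linarith
  have lim1 : Filter.Tendsto (fun n => L n 1) Filter.atTop (nhds 0) := by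
    convert lim 1 (by linarith) using 2
    have h3 : Gamma 3 = 2 := by
      have := Gamma_nat_eq_factorial 2
      rw [show ((2 : ℕ) : ℝ) + 1 = 3 by norm_num] at this
      rw [this]; norm_num [Nat.factorial]
    have : log √2 + log √2 = log 2 := by
      rw [← log_mul (by linarith) (by linarith), qq]
    norm_num [h3]
    linarith
  have main : ∀ n : ℕ, 1 ≤ n → L n 0 * (1 - 3 * s ^ 2 + 2 * s ^ 3) + L n 1 * (3 * s ^ 2 - 2 * s ^ 3)
      + (-(2 / ((n : ℝ) + 2))) * (s - 2 * s ^ 2 + s ^ 3) + 0 * (s ^ 3 - s ^ 2)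
      + (3 / 25) / 24 * (s ^ 2 * (s - 1) ^ 2) ≤ L n s := by
    intro n hn
    let C : ℝ := 3 * log n + log n.factorial
    let G : ℝ → ℝ := fun t => ∑ m ∈ Finset.range (n + 1),
      (-2 * log (1 * t + (m + 2)) + log (2 * t + (m + 1)))
        + (C - log (1 * t + (√2 - 1))) + (- log ((-1) * t + (√2 + 1)))
    let G1 : ℝ → ℝ := fun t => ∑ m ∈ Finset.range (n + 1),
      ((-2) / (1 * t + (m + 2)) ^ 1 + 2 / (2 * t + (m + 1)) ^ 1)
        + (-1) / (1 * t + (√2 - 1)) ^ 1 + 1 / ((-1) * t + (√2 + 1)) ^ 1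
    let G2 : ℝ → ℝ := fun t => ∑ m ∈ Finset.range (n + 1),
      (2 / (1 * t + (m + 2)) ^ 2 + (-4) / (2 * t + (m + 1)) ^ 2)
        + 1 / (1 * t + (√2 - 1)) ^ 2 + 1 / ((-1) * t + (√2 + 1)) ^ 2
    let G3 : ℝ → ℝ := fun t => ∑ m ∈ Finset.range (n + 1),
      ((-4) / (1 * t + (m + 2)) ^ 3 + 16 / (2 * t + (m + 1)) ^ 3)
        + (-2) / (1 * t + (√2 - 1)) ^ 3 + 2 / ((-1) * t + (√2 + 1)) ^ 3
    let G4 : ℝ → ℝ := fun t => ∑ m ∈ Finset.range (n + 1),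
      (12 / (1 * t + (m + 2)) ^ 4 + (-96) / (2 * t + (m + 1)) ^ 4)
        + 6 / (1 * t + (√2 - 1)) ^ 4 + 6 / ((-1) * t + (√2 + 1)) ^ 4
    have hm : ∀ m : ℕ, (0 : ℝ) ≤ m := fun m => m.cast_nonneg
    have p1 : ∀ t, 1 - √2 < t → ∀ m : ℕ, 1 * t + ((m : ℝ) + 2) ≠ 0 := fun t ht m =>
      ne_of_gt (by linarith [hm m])
    have p2 : ∀ t, 1 - √2 < t → ∀ m : ℕ, 2 * t + ((m : ℝ) + 1) ≠ 0 := fun t ht m =>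
      ne_of_gt (by linarith [hm m])
    have p3 : ∀ t, 1 - √2 < t → 1 * t + (√2 - 1) ≠ 0 := fun t ht => ne_of_gt (by linarith)
    have p4 : ∀ t, t < 1 + √2 → (-1) * t + (√2 + 1) ≠ 0 := fun t ht => ne_of_gt (by linarith)
    have h0 : ∀ t, 1 - √2 < t → t < 1 + √2 → HasDerivAt G (G1 t) t := by
      intro t ht ht'
      refine gri_sum_deriv (F' := fun m t => (-2) / (1 * t + (m + 2)) ^ 1
        + 2 / (2 * t + (m + 1)) ^ 1) (fun m => ?_) ?_ ?_
      · refine (((gri_dlog _ _ t (p1 t ht m)).const_mul (-2)).add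
          (gri_dlog _ _ t (p2 t ht m))).congr_deriv ?_
        ring
      · refine ((gri_dlog _ _ t (p3 t ht)).const_sub C).congr_deriv ?_
        ring
      · refine ((gri_dlog _ _ t (p4 t ht')).neg).congr_deriv ?_
        ring
    have h1 : ∀ t, 1 - √2 < t → t < 1 + √2 → HasDerivAt G1 (G2 t) t := by
      intro t ht ht'
      refine gri_sum_deriv (F' := fun m t => 2 / (1 * t + (m + 2)) ^ 2
        + (-4) / (2 * t + (m + 1)) ^ 2) (fun m => ?_) ?_ ?_
      · refine ((gri_dpow _ _ _ _ t (p1 t ht m)).add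
          (gri_dpow _ _ _ _ t (p2 t ht m))).congr_deriv ?_
        norm_num
      · refine (gri_dpow _ _ _ _ t (p3 t ht)).congr_deriv ?_
        norm_num
      · refine (gri_dpow _ _ _ _ t (p4 t ht')).congr_deriv ?_
        norm_num
    have h2 : ∀ t, 1 - √2 < t → t < 1 + √2 → HasDerivAt G2 (G3 t) t := by
      intro t ht ht'
      refine gri_sum_deriv (F' := fun m t => (-4) / (1 * t + (m + 2)) ^ 3
        + 16 / (2 * t + (m + 1)) ^ 3) (fun m => ?_) ?_ ?_
      · refine ((gri_dpow _ _ _ _ t (p1 t ht m)).add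
          (gri_dpow _ _ _ _ t (p2 t ht m))).congr_deriv ?_
        norm_num
      · refine (gri_dpow _ _ _ _ t (p3 t ht)).congr_deriv ?_
        norm_num
      · refine (gri_dpow _ _ _ _ t (p4 t ht')).congr_deriv ?_
        norm_num
    have h3 : ∀ t, 1 - √2 < t → t < 1 + √2 → HasDerivAt G3 (G4 t) t := by
      intro t ht ht'
      refine gri_sum_deriv (F' := fun m t => 12 / (1 * t + (m + 2)) ^ 4
        + (-96) / (2 * t + (m + 1)) ^ 4) (fun m => ?_) ?_ ?_
      · refine ((gri_dpow _ _ _ _ t (p1 t ht m)).add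
          (gri_dpow _ _ _ _ t (p2 t ht m))).congr_deriv ?_
        norm_num
      · refine (gri_dpow _ _ _ _ t (p3 t ht)).congr_deriv ?_
        norm_num
      · refine (gri_dpow _ _ _ _ t (p4 t ht')).congr_deriv ?_
        norm_num
    have h4 : ∀ t, 1 - √2 < t → t < 1 + √2 → 3 / 25 ≤ G4 t := by
      intro t ht ht'
      have key := gri_fourth ht ht' (n + 1)
      have e : G4 t = 6 * (∑ m ∈ Finset.range (n + 1),
          (2 * (1 / (t + m + 2) ^ 4) - 1 / (t + (m + 1) / 2) ^ 4)
          + 1 / (t + (√2 - 1)) ^ 4 + 1 / (√2 + 1 - t) ^ 4) := by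
        simp only [G4]
        rw [mul_add, mul_add, Finset.mul_sum]
        congr 1
        · congr 1
          · refine Finset.sum_congr rfl fun m _ => ?_
            rw [show 2 * t + ((m : ℝ) + 1) = 2 * (t + (m + 1) / 2) by ring, mul_pow,
              show 1 * t + ((m : ℝ) + 2) = t + m + 2 by ring]
            generalize t + ((m : ℝ) + 1) / 2 = y
            generalize t + (m : ℝ) + 2 = x
            ring
          · rw [one_mul]; ring
        · rw [show (-1) * t + (√2 + 1) = √2 + 1 - t by ring]; ring
      rw [e]; linarith
    have hGL : ∀ t, G t = L n t := by
      intro t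
      simp only [G, L, C, BohrMollerup.logGammaSeq, Finset.sum_add_distrib, ← Finset.mul_sum]
      have e1 : ∑ m ∈ Finset.range (n + 1), log (1 * t + ((m : ℝ) + 2))
          = ∑ m ∈ Finset.range (n + 1), log (t + 2 + m) :=
        Finset.sum_congr rfl fun m _ => by congr 1; ring
      have e2 : ∑ m ∈ Finset.range (n + 1), log (2 * t + ((m : ℝ) + 1))
          = ∑ m ∈ Finset.range (n + 1), log (2 * t + 1 + m) :=
        Finset.sum_congr rfl fun m _ => by congr 1; ring
      rw [e1, e2, one_mul, show (-1) * t + (√2 + 1) = √2 + 1 - t by ring]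
      ring
    have G10 : G1 0 = -(2 / ((n : ℝ) + 2)) := by
      have e : ∀ k : ℕ, ∑ m ∈ Finset.range k, ((-2) / ((m : ℝ) + 2) + 2 / ((m : ℝ) + 1))
          = 2 - 2 / ((k : ℝ) + 1) := by
        intro k
        induction k with
        | zero => simp
        | succ k ih =>
          rw [Finset.sum_range_succ, ih]
          push_cast
          rw [show (k : ℝ) + 1 + 1 = k + 2 by ring]
          ring
      have e' := e (n + 1)
      push_cast at e'
      rw [show (n : ℝ) + 1 + 1 = n + 2 by ring] at e'
      simp only [G1, mul_zero, zero_add, pow_one]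
      rw [e']
      have i1 : (-1) / (√2 - 1) = -(√2 + 1) := by
        rw [div_eq_iff (by linarith)]; linarith
      have i2 : 1 / (√2 + 1) = √2 - 1 := by
        rw [div_eq_iff (by linarith)]; linarith
      rw [i1, i2]; ring
    have G11 : G1 1 = 0 := by
      simp only [G1, mul_one, pow_one]
      rw [Finset.sum_eq_zero]
      · rw [show 1 + (√2 - 1) = √2 by ring, show -1 + (√2 + 1) = √2 by ring]; ring
      · intro m _
        rw [show (1 : ℝ) + (m + 2) = 2 + (m + 1) by ring]; ring
    have := gri_hermite (by linarith) (by linarith) h0 h1 h2 h3 h4 hs hs' s0 s1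
    rwa [hGL, hGL, hGL, G10, G11] at this
  have hn : Filter.Tendsto (fun n : ℕ => -(2 / ((n : ℝ) + 2))) Filter.atTop (nhds 0) := by
    have : Filter.Tendsto (fun n : ℕ => (n : ℝ) + 2) Filter.atTop Filter.atTop :=
      Filter.tendsto_atTop_add_const_right _ _ tendsto_natCast_atTop_atTop
    simpa using (this.const_div_atTop 2).neg
  have hl := ((((lim0.mul_const (1 - 3 * s ^ 2 + 2 * s ^ 3)).add
    (lim1.mul_const (3 * s ^ 2 - 2 * s ^ 3))).add
    (hn.mul_const (s - 2 * s ^ 2 + s ^ 3))).add_const (0 * (s ^ 3 - s ^ 2))).add_const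
    ((3 / 25) / 24 * (s ^ 2 * (s - 1) ^ 2))
  have := le_of_tendsto_of_tendsto hl (lim s hs)
    (Filter.eventually_atTop.mpr ⟨1, fun n h => main n h⟩)
  have hpos : 0 < s ^ 2 * (s - 1) ^ 2 := by
    have := sub_ne_zero.mpr s1
    positivity
  refine lt_of_lt_of_le ?_ this
  simp only [zero_mul, zero_add]
  positivity

lemma gri_strict (s : ℝ) (hs : -(3 / 2 : ℝ) ≤ s) (s0 : s ≠ 0) (s1 : s ≠ 1) :
    1 + 2 * s - s ^ 2 < Real.Gamma (s + 2) ^ 2 / Real.Gamma (2 * s + 1) := by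
  obtain ⟨q1, q2⟩ := gri_sqrt
  norm_num at q1 q2
  have qq : √2 * √2 = 2 := Real.mul_self_sqrt (by norm_num)
  have gp : 0 < Gamma (s + 2) := Gamma_pos_of_pos (by linarith)
  have fac : 1 + 2 * s - s ^ 2 = (s + (√2 - 1)) * (√2 + 1 - s) := by linarith
  rcases lt_or_ge (-(1 / 2)) s with h | h
  · have gp' : 0 < Gamma (2 * s + 1) := Gamma_pos_of_pos (by linarith)
    by_cases hI : 1 - √2 < s ∧ s < 1 + √2
    · have key := gri_log s hI.1 hI.2 s0 s1
      have u : 0 < s + (√2 - 1) := by linarith [hI.1]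
      have v : 0 < √2 + 1 - s := by linarith [hI.2]
      rw [fac, ← log_lt_log_iff (by positivity) (by positivity), log_mul u.ne' v.ne',
        log_div (by positivity) gp'.ne', log_pow]
      push_cast
      linarith
    · have : 1 + 2 * s - s ^ 2 ≤ 0 := by
        rw [fac]
        by_cases h1 : 1 - √2 < s
        · have h2 : 1 + √2 ≤ s := by
            by_contra h3
            exact hI ⟨h1, by linarith⟩
          exact mul_nonpos_of_nonneg_of_nonpos (by linarith) (by linarith)
        · exact mul_nonpos_of_nonpos_of_nonneg (by linarith) (by linarith)
      exact lt_of_le_of_lt this (by positivity)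
  · have neg : 1 + 2 * s - s ^ 2 < 0 := by nlinarith
    rcases eq_or_lt_of_le h with rfl | h
    · norm_num [Gamma_zero] at *
    rcases lt_trichotomy s (-1) with h1 | rfl | h1
    · have e1 := Gamma_add_one (s := 2 * s + 1) (by linarith)
      have e2 := Gamma_add_one (s := 2 * s + 1 + 1) (by linarith)
      have e3 : 0 ≤ Gamma (2 * s + 1 + 1 + 1) := Gamma_nonneg_of_nonneg (by linarith)
      rw [e2, e1, ← mul_assoc] at e3
      have e4 : 0 < (2 * s + 1 + 1) * (2 * s + 1) :=
        mul_pos_of_neg_of_neg (by linarith) (by linarith)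
      have e5 : 0 ≤ Gamma (2 * s + 1) := nonneg_of_mul_nonneg_right e3 e4
      exact lt_of_lt_of_le neg (by positivity)
    · have : Gamma (-1) = 0 := by simpa using Gamma_neg_nat_eq_zero 1
      norm_num [this]
    · have e1 := Gamma_add_one (s := 2 * s + 1) (by linarith)
      have e2 := Gamma_add_one (s := 2 * s + 1 + 1) (by linarith)
      have g3 : 0 < Gamma (2 * s + 3) := Gamma_pos_of_pos (by linarith)
      rw [show 2 * s + 1 + 1 + 1 = 2 * s + 3 by ring, e1] at e2
      have hc := Gamma_mul_add_mul_le_rpow_Gamma_mul_rpow_Gamma (s := 2 * s + 3) (t := 1)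
        (a := 1 / 2) (b := 1 / 2) (by linarith) one_pos (by norm_num) (by norm_num) (by norm_num)
      rw [show 1 / 2 * (2 * s + 3) + 1 / 2 * 1 = s + 2 by ring, Gamma_one, one_rpow, mul_one,
        ← sqrt_eq_rpow] at hc
      have hc2 : Gamma (s + 2) ^ 2 ≤ Gamma (2 * s + 3) := by
        have := pow_le_pow_left₀ gp.le hc 2
        rwa [sq_sqrt g3.le] at this
      have hp : (2 * s + 1 + 1) * (2 * s + 1) < 0 := mul_neg_of_pos_of_neg (by linarith) (by linarith)
      have hg : Gamma (2 * s + 1) = Gamma (2 * s + 3) / ((2 * s + 1 + 1) * (2 * s + 1)) := by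
        rw [e2, eq_div_iff hp.ne]; ring
      rw [hg, div_div_eq_mul_div, lt_div_iff₀ g3]
      nlinarith [mul_le_mul_of_nonpos_right hc2 hp.le, mul_pos g3 (by nlinarith [sq_nonneg (5 * s + 2)] : 0 < 5 * s ^ 2 + 4 * s + 1)]

/-- **Corollary GIneq.** For every real `s ≥ −3/2` one has
`Γ(s+2)²/Γ(2s+1) ≥ 1 + 2s − s²`, with strict inequality for `s ∉ {0, 1}`.
(At `s = −1` and `s = −3/2` the Gamma function in the denominator is evaluated at a
nonpositive integer, where `1/Γ` vanishes, so the left-hand side is `0`.) -/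
theorem gamma_ratio_inequality (s : ℝ) (hs : -(3 / 2 : ℝ) ≤ s) :
    1 + 2 * s - s ^ 2 ≤ Real.Gamma (s + 2) ^ 2 / Real.Gamma (2 * s + 1)
    ∧ (s ≠ 0 → s ≠ 1 →
        1 + 2 * s - s ^ 2 < Real.Gamma (s + 2) ^ 2 / Real.Gamma (2 * s + 1)) := by
  refine ⟨?_, gri_strict s hs⟩
  by_cases s0 : s = 0
  · subst s0; norm_num [Gamma_two]
  by_cases s1 : s = 1
  · subst s1
    have h3 : Gamma 3 = 2 := by
      have := Gamma_nat_eq_factorial 2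
      rw [show ((2 : ℕ) : ℝ) + 1 = 3 by norm_num] at this
      rw [this]; norm_num [Nat.factorial]
    norm_num [h3]
  exact (gri_strict s hs s0 s1).le
end
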